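/- arXiv:nlin/0701059 — 3 statements merged into one kernel-verified Lean document; each statement's English description precedes it below -/
import Mathlib

section
/- Let n ≥ 2 and k > 1, and let F, G : ℂⁿ → ℂⁿ be two polynomial maps, all components homogeneous of degree k, such that for each of them the set of nonzero solutions of F(d) = d (respectively G(d) = d) has exactly kⁿ − 1 elements and at each such solution the Kovalevskaya matrix is nonsingular. Let S be any symmetric homogeneous polynomial in n−1 variables of degree less than n. Then Σ_{d≠0, F(d)=d} S(Λ(d))/τ_{n−1}(Λ(d)) = Σ_{d≠0, G(d)=d} S(Λ(d))/τ_{n−1}(Λ(d)); i.e. the number R = Σ_{Darboux points} S(Λ(d))/τ_{n−1}(Λ(d)) depends only on S, n and k, not on the system. -/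
open MvPolynomial

lemma gl_sum_pow (T : Finset ℂ) (a : ℕ) (ha : a + 1 < T.card) :
    ∑ x ∈ T, x ^ a / ∏ y ∈ T.erase x, (x - y) = 0 := by
  have h := Lagrange.coeff_eq_sum (s := T) (v := id) (P := (Polynomial.X : Polynomial ℂ) ^ a)
    (Set.injOn_id _) (by rw [Polynomial.degree_X_pow]; exact_mod_cast (by omega))
  rw [Polynomial.coeff_X_pow, if_neg (by omega)] at h
  simpa using h.symm

lemma gl_grid_sum {n : ℕ} (T : Finset ℂ) (Q : MvPolynomial (Fin n) ℂ)
    (hQ : Q.totalDegree < n * (T.card - 1)) :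
    ∑ x ∈ Fintype.piFinset (fun _ : Fin n => T),
      eval x Q / ∏ j, ∏ y ∈ T.erase (x j), (x j - y) = 0 := by
  simp_rw [eval_eq', Finset.sum_div]
  rw [Finset.sum_comm]
  refine Finset.sum_eq_zero fun a ha => ?_
  simp_rw [mul_div_assoc, ← Finset.mul_sum, ← Finset.prod_div_distrib]
  rw [Finset.sum_prod_piFinset T (fun j x => x ^ a j / ∏ y ∈ T.erase x, (x - y))]
  have : ∃ j, a j + 1 < T.card := by
    by_contra! hcon
    have h1 : n * (T.card - 1) ≤ ∑ j, a j := by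
      calc n * (T.card - 1) = ∑ j : Fin n, (T.card - 1) := by simp
        _ ≤ _ := Finset.sum_le_sum fun j _ => by have := hcon j; omega
    have h2 := le_totalDegree ha
    rw [Finsupp.sum_fintype _ _ (fun _ => rfl)] at h2
    omega
  obtain ⟨j, hj⟩ := this
  rw [Finset.prod_eq_zero (Finset.mem_univ j) (gl_sum_pow T (a j) hj), mul_zero]

lemma gl_totalDegree_det {n : ℕ} (A : Matrix (Fin n) (Fin n) (MvPolynomial (Fin n) ℂ)) (r : ℕ)
    (hA : ∀ i j, (A i j).totalDegree ≤ r) : A.det.totalDegree ≤ n * r := by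
  rw [Matrix.det_apply']
  refine totalDegree_finsetSum_le fun σ _ => ?_
  have : ((Equiv.Perm.sign σ : ℤ) : MvPolynomial (Fin n) ℂ) = C ((Equiv.Perm.sign σ : ℤ) : ℂ) := by
    simp
  rw [this]
  refine (totalDegree_mul _ _).trans ?_
  rw [totalDegree_C, zero_add]
  refine (totalDegree_finsetProd _ _).trans ?_
  calc _ ≤ ∑ i : Fin n, r := Finset.sum_le_sum fun i _ => hA _ _
    _ = _ := by simp

/-- separating polynomials -/
lemma gl_separate {n : ℕ} (Z : Finset (Fin n → ℂ)) (z : Fin n → ℂ) (hz : z ∉ Z) :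
    ∃ h : MvPolynomial (Fin n) ℂ, h.totalDegree ≤ Z.card ∧ eval z h ≠ 0 ∧
      ∀ d ∈ Z, eval d h = 0 := by
  classical
  have hex : ∀ d ∈ Z, ∃ i, z i ≠ d i := fun d hd => by
    by_contra! hcon
    exact hz (by rwa [show z = d from funext hcon])
  rcases isEmpty_or_nonempty (Fin n) with hemp | hne
  · have hZ : Z = ∅ := Finset.eq_empty_of_forall_notMem fun d hd => by
      obtain ⟨i, -⟩ := hex d hd
      exact hemp.elim i
    exact ⟨1, by simp, by simp, by simp [hZ]⟩
  choose! c hc using hex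
  refine ⟨∏ d ∈ Z, (X (c d) - C (d (c d))), ?_, ?_, ?_⟩
  · refine (totalDegree_finsetProd _ _).trans ?_
    calc _ ≤ ∑ d ∈ Z, 1 := Finset.sum_le_sum fun d _ => ?_
      _ = _ := by simp
    refine (totalDegree_sub _ _).trans ?_
    simp
  · rw [map_prod, Finset.prod_ne_zero_iff]
    intro d hd
    simpa [sub_eq_zero] using hc d hd
  · intro d hd
    rw [map_prod]
    exact Finset.prod_eq_zero hd (by simp)

/-- the map from reduced coefficient vectors to values -/
noncomputable def glRed (n k : ℕ) (w : (Fin n → Fin k) → ℂ) : MvPolynomial (Fin n) ℂ :=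
  ∑ a, C (w a) * ∏ i, X i ^ (a i : ℕ)

lemma gl_ideal {n k N : ℕ} (Q : Fin n → MvPolynomial (Fin n) ℂ) (Z : Finset (Fin n → ℂ))
    (hZ : ∀ d ∈ Z, ∀ i, eval d (Q i) = 0) (hcard : Z.card = k ^ n) (hN : k ^ n ≤ N)
    (hsurj : ∀ h : MvPolynomial (Fin n) ℂ, h.totalDegree ≤ N →
      ∃ (w : (Fin n → Fin k) → ℂ) (A : Fin n → MvPolynomial (Fin n) ℂ),
        (∀ i, (A i).totalDegree ≤ N - k) ∧ h = glRed n k w + ∑ i, A i * Q i)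
    (h : MvPolynomial (Fin n) ℂ) (hh : h.totalDegree ≤ N) (hv : ∀ d ∈ Z, eval d h = 0) :
    ∃ A : Fin n → MvPolynomial (Fin n) ℂ,
        (∀ i, (A i).totalDegree ≤ N - k) ∧ h = ∑ i, A i * Q i := by
  classical
  let ev : ((Fin n → Fin k) → ℂ) →ₗ[ℂ] (Z → ℂ) :=
    { toFun := fun w d => eval d.1 (glRed n k w)
      map_add' := fun w w' => by
        funext d; simp [glRed, add_mul, Finset.sum_add_distrib]
      map_smul' := fun c w => by
        funext d; simp [glRed, Finset.mul_sum, mul_assoc] }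
  have hsur : Function.Surjective ev := by
    intro v
    have hsep : ∀ d : Z, ∃ h : MvPolynomial (Fin n) ℂ, h.totalDegree ≤ N ∧ eval d.1 h ≠ 0 ∧
      ∀ d' ∈ Z.erase d.1, eval d' h = 0 := by
      intro d
      obtain ⟨h, h1, h2, h3⟩ := gl_separate (Z.erase d.1) d.1 (by simp)
      exact ⟨h, h1.trans ((Finset.card_le_card (Finset.erase_subset _ _)).trans (hcard ▸ hN)),
        h2, h3⟩
    choose e he1 he2 he3 using hsep
    obtain ⟨w, A, -, hw⟩ := hsurj (∑ d : Z, C (v d / eval d.1 (e d)) * e d) (by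
      refine totalDegree_finsetSum_le fun d _ => (totalDegree_mul _ _).trans ?_
      simpa using he1 d)
    refine ⟨w, funext fun d => ?_⟩
    have := congrArg (eval d.1) hw
    simp only [map_add, map_sum, map_mul, hZ d.1 d.2, mul_zero, Finset.sum_const_zero, add_zero,
      eval_C] at this
    change eval d.1 (glRed n k w) = _
    rw [← this, Finset.sum_eq_single d]
    · field_simp [he2 d]
    · intro d' _ hne
      rw [he3 d' d.1 (by simp [Subtype.coe_injective.ne hne.symm]), mul_zero]
    · simp
  have hinj : Function.Injective ev := by
    refine (LinearMap.injective_iff_surjective_of_finrank_eq_finrank ?_).2 hsur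
    simp [hcard]
  obtain ⟨w, A, hA, hw⟩ := hsurj h hh
  have hw0 : w = 0 := by
    refine hinj ?_
    rw [map_zero]
    funext d
    have := congrArg (eval d.1) hw
    simp only [map_add, map_sum, map_mul, hZ d.1 d.2, mul_zero, Finset.sum_const_zero, add_zero,
      hv d.1 d.2] at this
    exact this.symm
  refine ⟨A, hA, ?_⟩
  rw [hw, hw0]
  simp [glRed]

lemma gl_ej_generic {n k N : ℕ} (hn : 1 ≤ n) (hkN : k ≤ N) (hk : 1 ≤ k)
    (Q : Fin n → MvPolynomial (Fin n) ℂ) (Z : Finset (Fin n → ℂ))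
    (hZ : ∀ d ∈ Z, ∀ i, eval d (Q i) = 0) (hcard : Z.card = k ^ n) (hN : n * k ^ n ≤ N)
    (hsurj : ∀ h : MvPolynomial (Fin n) ℂ, h.totalDegree ≤ N →
      ∃ (w : (Fin n → Fin k) → ℂ) (A : Fin n → MvPolynomial (Fin n) ℂ),
        (∀ i, (A i).totalDegree ≤ N - k) ∧ h = glRed n k w + ∑ i, A i * Q i)
    (g : MvPolynomial (Fin n) ℂ) (hg : g.totalDegree < n * (k - 1)) :
    ∑ d ∈ Z, eval d g / (Matrix.of fun i j => eval d (pderiv j (Q i))).det = 0 := by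
  classical
  have hNk : k ^ n ≤ N := le_trans (Nat.le_mul_of_pos_left _ hn) hN
  have hid := gl_ideal Q Z hZ hcard hNk hsurj
  have hall : ∀ z, (∀ i, eval z (Q i) = 0) → z ∈ Z := by
    intro z hz
    by_contra hcon
    obtain ⟨h, h1, h2, h3⟩ := gl_separate Z z hcon
    obtain ⟨A, -, hA⟩ := hid h (h1.trans (hcard ▸ hNk)) h3
    apply h2
    rw [hA]
    simp [hz]
  obtain ⟨T, hT, hTc⟩ := Infinite.exists_superset_card_eq
    (Finset.univ.biUnion fun j : Fin n => Z.image fun d => d j) N (by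
      refine (Finset.card_biUnion_le).trans ?_
      calc _ ≤ ∑ j : Fin n, k ^ n := Finset.sum_le_sum fun j _ => hcard ▸ Finset.card_image_le
        _ = n * k ^ n := by simp
        _ ≤ N := hN)
  have hmem : ∀ d ∈ Z, ∀ j, d j ∈ T := fun d hd j => hT (by
    simp only [Finset.mem_biUnion, Finset.mem_image, Finset.mem_univ, true_and]
    exact ⟨j, d, hd, rfl⟩)
  let f : Fin n → MvPolynomial (Fin n) ℂ := fun j => ∏ y ∈ T, (X j - C y)
  have hfe : ∀ j x, eval x (f j) = ∏ y ∈ T, (x j - y) := fun j x => by simp [f, map_prod]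
  have hf0 : ∀ j x, x j ∈ T → eval x (f j) = 0 := fun j x hx => by
    rw [hfe]; exact Finset.prod_eq_zero hx (sub_self _)
  have hfd : ∀ j, (f j).totalDegree ≤ N := fun j => by
    refine (totalDegree_finsetProd _ _).trans ?_
    calc _ ≤ ∑ y ∈ T, 1 := Finset.sum_le_sum fun d _ => ?_
      _ = _ := by simp [hTc]
    refine (totalDegree_sub _ _).trans ?_
    simp
  have hA := fun j => hid (f j) (hfd j) (fun d hd => hf0 j d (hmem d hd j))
  choose A hAd hAf using hA
  have hfp : ∀ j l x, x j ∈ T → eval x (pderiv l (f j)) =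
      if j = l then ∏ y ∈ T.erase (x j), (x j - y) else 0 := by
    intro j l x hx
    have : f j = (X j - C (x j)) * ∏ y ∈ T.erase (x j), (X j - C y) :=
      (Finset.mul_prod_erase T (fun y => X j - C y) hx).symm
    rw [this, Derivation.leibniz]
    simp [pderiv_X, Pi.single_apply]
    split_ifs <;> simp_all
  let B : Matrix (Fin n) (Fin n) (MvPolynomial (Fin n) ℂ) := Matrix.of A
  have hBd : B.det.totalDegree ≤ n * (N - k) := gl_totalDegree_det B _ hAd
  have hBe : ∀ x, eval x B.det = (Matrix.of fun j i => eval x (A j i)).det := fun x => by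
    rw [RingHom.map_det]; rfl
  have hgrid := gl_grid_sum T (g * B.det) (by
    rw [hTc]
    refine (totalDegree_mul _ _).trans_lt ?_
    calc _ < n * (k - 1) + n * (N - k) := by omega
      _ = n * (N - 1) := by rw [← mul_add]; congr 1; omega)
  rw [← hgrid]
  have hsub : Z ⊆ Fintype.piFinset (fun _ : Fin n => T) := fun d hd => by
    rw [Fintype.mem_piFinset]; exact hmem d hd
  rw [← Finset.sum_subset hsub]
  · refine Finset.sum_congr rfl fun d hd => ?_
    have hprod : (Matrix.of fun j i => eval d (A j i)) *
        (Matrix.of fun i j => eval d (pderiv j (Q i))) =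
        Matrix.diagonal (fun j => ∏ y ∈ T.erase (d j), (d j - y)) := by
      ext j l
      rw [Matrix.mul_apply, Matrix.diagonal_apply, ← hfp j l d (hmem d hd j), hAf j]
      simp [Derivation.leibniz, hZ d hd]
    have hdet := congrArg Matrix.det hprod
    rw [Matrix.det_mul, Matrix.det_diagonal, ← hBe] at hdet
    have hne : ∏ j, ∏ y ∈ T.erase (d j), (d j - y) ≠ 0 := by
      rw [Finset.prod_ne_zero_iff]
      intro j _
      rw [Finset.prod_ne_zero_iff]
      intro y hy
      exact sub_ne_zero.2 (Finset.ne_of_mem_erase hy).symm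
    rw [← hdet] at hne ⊢
    rw [map_mul]
    have h1 := left_ne_zero_of_mul hne
    have h2 := right_ne_zero_of_mul hne
    field_simp
  · intro x hx hxZ
    rw [map_mul]
    suffices eval x B.det = 0 by rw [this]; simp
    rw [hBe]
    by_contra hne
    have := Matrix.eq_zero_of_mulVec_eq_zero hne (v := fun i => eval x (Q i)) (by
      funext j
      have h0 := hf0 j x (Fintype.mem_piFinset.1 hx j)
      rw [hAf j] at h0
      simpa [Matrix.mulVec, dotProduct] using h0)
    exact hxZ (hall x (fun i => congrFun this i))

lemma gl_finite_bad {E V : Type*} [AddCommGroup E] [Module ℂ E] [AddCommGroup V] [Module ℂ V]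
    [FiniteDimensional ℂ V] (A B : E →ₗ[ℂ] V) (hA : Function.Surjective A) :
    {t : ℂ | ¬ Function.Surjective (t • A + B)}.Finite := by
  obtain ⟨σ, hσ⟩ := LinearMap.exists_rightInverse_of_surjective A (LinearMap.range_eq_top.2 hA)
  refine ((Module.End.finite_hasEigenvalue (-(B ∘ₗ σ) : Module.End ℂ V))).subset ?_
  intro t ht
  by_contra hcon
  apply ht
  have hinj : Function.Injective ((t • A + B) ∘ₗ σ) := by
    rw [← LinearMap.ker_eq_bot, LinearMap.ker_eq_bot']
    intro v hv
    by_contra hv0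
    apply hcon
    refine Module.End.hasEigenvalue_of_hasEigenvector (x := v) ⟨?_, hv0⟩
    rw [Module.End.mem_eigenspace_iff]
    have h1 : A (σ v) = v := LinearMap.congr_fun hσ v
    simp only [LinearMap.comp_apply, LinearMap.add_apply, LinearMap.smul_apply, h1] at hv
    simp only [LinearMap.neg_apply, LinearMap.comp_apply]
    exact (eq_neg_of_add_eq_zero_left hv).symm
  have hsur := LinearMap.surjective_of_injective hinj
  intro v
  obtain ⟨x, hx⟩ := hsur v
  exact ⟨σ x, hx⟩

lemma gl_monomial_decomp {n k N : ℕ} (hkN : k ≤ N) (h : MvPolynomial (Fin n) ℂ)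
    (hh : h.totalDegree ≤ N) :
      ∃ (w : (Fin n → Fin k) → ℂ) (A : Fin n → MvPolynomial (Fin n) ℂ),
        (∀ i, (A i).totalDegree ≤ N - k) ∧ h = glRed n k w + ∑ i, A i * X i ^ k := by
  classical
  let U : Submodule ℂ (MvPolynomial (Fin n) ℂ) :=
    { carrier := {h | ∃ (w : (Fin n → Fin k) → ℂ) (A : Fin n → MvPolynomial (Fin n) ℂ),
        (∀ i, (A i).totalDegree ≤ N - k) ∧ h = glRed n k w + ∑ i, A i * X i ^ k}
      add_mem' := by
        rintro _ _ ⟨w, A, hA, rfl⟩ ⟨w', A', hA', rfl⟩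
        refine ⟨w + w', A + A', fun i => (totalDegree_add _ _).trans (max_le (hA i) (hA' i)), ?_⟩
        simp only [glRed, Pi.add_apply, map_add, add_mul, Finset.sum_add_distrib]
        ring
      zero_mem' := ⟨0, 0, by simp, by simp [glRed]⟩
      smul_mem' := by
        rintro c _ ⟨w, A, hA, rfl⟩
        refine ⟨c • w, fun i => c • A i, fun i => (totalDegree_smul_le _ _).trans (hA i), ?_⟩
        simp only [glRed, Pi.smul_apply, smul_eq_mul, map_mul, smul_eq_C_mul, mul_add,
          Finset.mul_sum, mul_assoc] }
  change h ∈ U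
  rw [h.as_sum]
  refine Submodule.sum_mem _ fun a ha => ?_
  have had : ∑ i, a i ≤ N := by
    have := (le_totalDegree ha).trans hh
    rwa [Finsupp.sum_fintype _ _ (fun _ => rfl)] at this
  have hmon : ∀ b : Fin n →₀ ℕ, ∀ c : ℂ, monomial b c = C c * ∏ i, X i ^ b i := fun b c => by
    rw [monomial_eq, Finsupp.prod_fintype _ _ (by simp)]
  by_cases hsm : ∀ i, a i < k
  · refine ⟨Pi.single (fun i => ⟨a i, hsm i⟩) (coeff a h), 0, by simp, ?_⟩
    rw [glRed, Finset.sum_eq_single (fun i => ⟨a i, hsm i⟩)]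
    · simp [hmon]
    · intro b _ hb
      simp [Pi.single_eq_of_ne hb]
    · simp
  · push Not at hsm
    obtain ⟨i, hi⟩ := hsm
    refine ⟨0, Pi.single i (monomial (a - Finsupp.single i k) (coeff a h)), ?_, ?_⟩
    · intro j
      rcases eq_or_ne j i with rfl | hj
      · rw [Pi.single_eq_same]
        refine (totalDegree_monomial_le _ _).trans ?_
        rw [Finsupp.sum_fintype _ _ (fun _ => rfl)]
        have : ∑ i, a i = ∑ i, (a - Finsupp.single j k) i + k := by
          conv_lhs => rw [← tsub_add_cancel_of_le (Finsupp.single_le_iff.2 hi)]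
          simp only [Finsupp.add_apply, Finset.sum_add_distrib]
          congr 1
          simp [Finsupp.single_apply]
        change ∑ i, (a - Finsupp.single j k) i ≤ N - k
        omega
      · simp [Pi.single_eq_of_ne hj]
    · rw [Finset.sum_eq_single i]
      · rw [Pi.single_eq_same, X_pow_eq_monomial, monomial_mul, mul_one,
          tsub_add_cancel_of_le (Finsupp.single_le_iff.2 hi)]
        simp [glRed]
      · intro j _ hj
        simp [Pi.single_eq_of_ne hj]
      · simp

lemma gl_totalDegree_red {n k N : ℕ} (hN : n * k ≤ N) (w : (Fin n → Fin k) → ℂ) :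
    (glRed n k w).totalDegree ≤ N := by
  refine totalDegree_finsetSum_le fun a _ => (totalDegree_mul _ _).trans ?_
  rw [totalDegree_C, zero_add]
  refine (totalDegree_finsetProd _ _).trans ?_
  calc _ ≤ ∑ i : Fin n, k := Finset.sum_le_sum fun i _ => by
        rw [totalDegree_X_pow]; exact (a i).2.le
    _ ≤ N := by simpa using hN

lemma gl_good {n k N : ℕ} (hkN : k ≤ N) (hN : n * k ≤ N) (P : Fin n → MvPolynomial (Fin n) ℂ)
    (hP : ∀ i, (P i).totalDegree ≤ k) :
    ∃ bad : Set ℂ, bad.Finite ∧ ∀ t ∉ bad, ∀ h : MvPolynomial (Fin n) ℂ, h.totalDegree ≤ N →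
      ∃ (w : (Fin n → Fin k) → ℂ) (A : Fin n → MvPolynomial (Fin n) ℂ),
        (∀ i, (A i).totalDegree ≤ N - k) ∧
          h = glRed n k w + ∑ i, A i * (C t * X i ^ k + P i) := by
  let V := restrictTotalDegree (Fin n) ℂ N
  let U := restrictTotalDegree (Fin n) ℂ (N - k)
  have hmul : ∀ (H : Fin n → MvPolynomial (Fin n) ℂ), (∀ i, (H i).totalDegree ≤ k) →
      ∀ A : Fin n → U, ∑ i, (A i).1 * H i ∈ V := by
    intro H hH A
    refine Submodule.sum_mem _ fun i _ => ?_
    rw [mem_restrictTotalDegree]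
    have := (mem_restrictTotalDegree _ _ _).1 (A i).2
    have := hH i
    refine (totalDegree_mul _ _).trans ?_
    omega
  have hX : ∀ i : Fin n, (X i ^ k : MvPolynomial (Fin n) ℂ).totalDegree ≤ k := fun i => by
    rw [totalDegree_X_pow]
  let L1 : (((Fin n → Fin k) → ℂ) × (Fin n → U)) →ₗ[ℂ] V :=
    { toFun := fun x => ⟨glRed n k x.1 + ∑ i, (x.2 i).1 * X i ^ k,
        V.add_mem ((mem_restrictTotalDegree _ _ _).2 (gl_totalDegree_red hN _)) (hmul _ hX _)⟩
      map_add' := fun x y => by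
        ext1
        simp only [glRed, Prod.fst_add, Prod.snd_add, Pi.add_apply, map_add, add_mul,
          Finset.sum_add_distrib, Submodule.coe_add]
        ring
      map_smul' := fun c x => by
        ext1
        simp only [glRed, Prod.smul_fst, Prod.smul_snd, Pi.smul_apply, smul_eq_mul, map_mul,
          smul_eq_C_mul, mul_add, Finset.mul_sum, mul_assoc, Submodule.coe_smul, RingHom.id_apply] }
  let L2 : (((Fin n → Fin k) → ℂ) × (Fin n → U)) →ₗ[ℂ] V :=
    { toFun := fun x => ⟨∑ i, (x.2 i).1 * P i, hmul _ hP _⟩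
      map_add' := fun x y => by
        ext1
        simp only [Prod.snd_add, Pi.add_apply, add_mul,
          Finset.sum_add_distrib, Submodule.coe_add]
      map_smul' := fun c x => by
        ext1
        simp only [Prod.smul_snd, Pi.smul_apply,
          smul_eq_C_mul, Finset.mul_sum, mul_assoc, Submodule.coe_smul, RingHom.id_apply] }
  have hL1 : Function.Surjective L1 := by
    rintro ⟨h, hh⟩
    obtain ⟨w, A, hA, hw⟩ := gl_monomial_decomp hkN h ((mem_restrictTotalDegree _ _ _).1 hh)
    exact ⟨(w, fun i => ⟨A i, (mem_restrictTotalDegree _ _ _).2 (hA i)⟩), Subtype.ext hw.symm⟩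
  refine ⟨_, gl_finite_bad L1 L2 hL1, fun t ht h hh => ?_⟩
  simp only [Set.mem_ofPred_eq, not_not] at ht
  obtain ⟨⟨w, A⟩, hw⟩ := ht ⟨h, (mem_restrictTotalDegree _ _ _).2 hh⟩
  refine ⟨t • w, fun i => (A i).1, fun i => (mem_restrictTotalDegree _ _ _).1 (A i).2, ?_⟩
  have := congrArg Subtype.val hw
  rw [← show _ = h from this]
  change t • (glRed n k w + ∑ i, (A i).1 * X i ^ k) + ∑ i, (A i).1 * P i = _
  simp only [glRed, Pi.smul_apply, smul_eq_mul, map_mul, smul_eq_C_mul, mul_add, Finset.mul_sum,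
    Finset.sum_add_distrib, mul_assoc]
  have : ∀ i, C t * ((A i).1 * X i ^ k) = (A i).1 * (C t * X i ^ k) := fun i => by ring
  simp only [this]
  ring

lemma gl_hasStrictFDerivAt {n : ℕ} (p : MvPolynomial (Fin n) ℂ) (x : Fin n → ℂ) :
    HasStrictFDerivAt (fun y : Fin n → ℂ => eval y p)
      (∑ j, eval x (pderiv j p) • (ContinuousLinearMap.proj (R := ℂ) (φ := fun _ : Fin n => ℂ) j))
      x := by
  classical
  induction p using MvPolynomial.induction_on with
  | C a =>
    convert! hasStrictFDerivAt_const (𝕜 := ℂ) a x using 1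
    · simp
    · ext v
      simp
  | add p q hp hq =>
    convert! hp.add hq using 1
    · ext v
      simp
    · ext v
      simp [add_mul, Finset.sum_add_distrib]
  | mul_X p i hp =>
    have h1 : HasStrictFDerivAt (fun y : Fin n → ℂ => y i)
      (ContinuousLinearMap.proj (R := ℂ) (φ := fun _ : Fin n => ℂ) i) x :=
      hasStrictFDerivAt_apply i x
    simp only [map_mul, eval_X]
    convert! hp.mul h1 using 1
    ext v
    simp [Derivation.leibniz, pderiv_X, Pi.single_apply, add_mul, Finset.sum_add_distrib,
      Finset.mul_sum, mul_assoc, apply_ite]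

/-- Continuation of a simple zero. -/
lemma gl_continuation {n k : ℕ} (P : Fin n → MvPolynomial (Fin n) ℂ) (d : Fin n → ℂ)
    (hd : ∀ i, eval d (P i) = 0)
    (hJ : (Matrix.of fun i j => eval d (pderiv j (P i))).det ≠ 0) :
    ∃ ψ : ℂ → (Fin n → ℂ), Filter.Tendsto ψ (nhds 0) (nhds d) ∧
      ∀ᶠ t in nhds 0, ∀ i, eval (ψ t) (C t * X i ^ k + P i) = 0 := by
  classical
  let M := Matrix.of fun i j => eval d (pderiv j (P i))
  let f : ℂ × (Fin n → ℂ) → (Fin n → ℂ) := fun u i => u.1 * u.2 i ^ k + eval u.2 (P i)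
  have hmain : ∃ f' : ℂ × (Fin n → ℂ) →L[ℂ] (Fin n → ℂ), HasStrictFDerivAt f f' (0, d) ∧
      ∀ v, f' (0, v) = M.mulVec v := by
    have hi : ∀ i, ∃ f'i : ℂ × (Fin n → ℂ) →L[ℂ] ℂ,
        HasStrictFDerivAt (fun u : ℂ × (Fin n → ℂ) => u.1 * u.2 i ^ k + eval u.2 (P i)) f'i (0, d)
        ∧ ∀ v, f'i (0, v) = M.mulVec v i := by
      intro i
      have h1 : HasStrictFDerivAt (fun u : ℂ × (Fin n → ℂ) => u.1)
        (ContinuousLinearMap.fst ℂ ℂ (Fin n → ℂ)) (0, d) := hasStrictFDerivAt_fst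
      have h2 : HasStrictFDerivAt (fun u : ℂ × (Fin n → ℂ) => u.2)
        (ContinuousLinearMap.snd ℂ ℂ (Fin n → ℂ)) (0, d) := hasStrictFDerivAt_snd
      have h3 := (hasStrictFDerivAt_apply (𝕜 := ℂ) (F' := fun _ : Fin n => ℂ) i d).comp
        ((0 : ℂ), d) h2
      have h4 := (gl_hasStrictFDerivAt (P i) d).comp ((0 : ℂ), d) h2
      refine ⟨_, (h1.mul (h3.pow k)).add h4, ?_⟩
      intro v
      simp [M, Matrix.mulVec, dotProduct]
    choose f' h1 h2 using hi
    refine ⟨ContinuousLinearMap.pi f', hasStrictFDerivAt_pi'.2 fun i => ?_, fun v => ?_⟩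
    · exact h1 i
    · funext i
      exact h2 i v
  obtain ⟨f', hf', hv⟩ := hmain
  have hinv : (f' ∘L .inr ℂ ℂ (Fin n → ℂ)).IsInvertible := by
    have hinj : Function.Injective (f' ∘L .inr ℂ ℂ (Fin n → ℂ) : (Fin n → ℂ) →ₗ[ℂ] (Fin n → ℂ)) := by
      rw [← LinearMap.ker_eq_bot, LinearMap.ker_eq_bot']
      intro v h0
      refine Matrix.eq_zero_of_mulVec_eq_zero hJ ?_
      rw [← hv v]
      exact h0
    let e := LinearEquiv.ofInjectiveEndo _ hinj
    refine ⟨e.toContinuousLinearEquiv, ?_⟩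
    ext v
    rfl
  have hz : f (0, d) = 0 := by
    funext i
    simp [f, hd]
  refine ⟨hf'.implicitFunctionOfProdDomain hinv, hf'.tendsto_implicitFunctionOfProdDomain hinv, ?_⟩
  filter_upwards [hf'.eventually_apply_implicitFunctionOfProdDomain hinv] with t ht i
  rw [hz] at ht
  simpa [f] using congrFun ht i

/-- Euler-Jacobi vanishing. -/
lemma gl_euler_jacobi {n k : ℕ} (hn : 1 ≤ n) (hk : 1 ≤ k)
    (P : Fin n → MvPolynomial (Fin n) ℂ) (hP : ∀ i, (P i).totalDegree ≤ k)
    (Z : Finset (Fin n → ℂ))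
    (hZ : ∀ d ∈ Z, ∀ i, eval d (P i) = 0) (hcard : Z.card = k ^ n)
    (hJ : ∀ d ∈ Z, (Matrix.of fun i j => eval d (pderiv j (P i))).det ≠ 0)
    (g : MvPolynomial (Fin n) ℂ) (hg : g.totalDegree < n * (k - 1)) :
    ∑ d ∈ Z, eval d g / (Matrix.of fun i j => eval d (pderiv j (P i))).det = 0 := by
  classical
  have hkk : k ≤ k ^ n := Nat.le_self_pow (by omega) k
  have hN : n * k ≤ n * k ^ n := Nat.mul_le_mul_left n hkk
  have hkN : k ≤ n * k ^ n := hkk.trans (Nat.le_mul_of_pos_left _ hn)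
  obtain ⟨bad, hbad, hgood⟩ := gl_good hkN hN P hP
  have hc := fun d : Z => gl_continuation (k := k) P d.1 (hZ d.1 d.2) (hJ d.1 d.2)
  choose ψ hψ1 hψ2 using hc
  let Q : ℂ → Fin n → MvPolynomial (Fin n) ℂ := fun t i => C t * X i ^ k + P i
  let Φ : ℂ → ℂ := fun t => ∑ d : Z, eval (ψ d t) g /
    (Matrix.of fun i j => eval (ψ d t) (pderiv j (Q t i))).det
  have hlim : Filter.Tendsto Φ (nhdsWithin 0 {0}ᶜ) (nhds (∑ d : Z, eval d.1 g /
      (Matrix.of fun i j => eval d.1 (pderiv j (P i))).det)) := by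
    refine Filter.Tendsto.mono_left ?_ nhdsWithin_le_nhds
    refine tendsto_finsetSum _ fun d _ => ?_
    refine Filter.Tendsto.div ?_ ?_ (hJ d.1 d.2)
    · exact ((MvPolynomial.continuous_eval g).tendsto d.1).comp (hψ1 d)
    · refine ((continuous_id.matrix_det).tendsto _).comp ?_
      refine tendsto_pi_nhds.2 fun i => tendsto_pi_nhds.2 fun j => ?_
      have h1 : ∀ p : MvPolynomial (Fin n) ℂ, Filter.Tendsto (fun t => eval (ψ d t) p) (nhds 0)
        (nhds (eval d.1 p)) := fun p => ((MvPolynomial.continuous_eval p).tendsto d.1).comp (hψ1 d)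
      have h2 := (Filter.tendsto_id (x := nhds (0 : ℂ))).mul (h1 (pderiv j (X i ^ k)))
      have h3 := h2.add (h1 (pderiv j (P i)))
      simp only [id, zero_mul, zero_add] at h3
      simpa [Q] using h3
  have hzero : ∀ᶠ t in nhdsWithin (0 : ℂ) {0}ᶜ, Φ t = 0 := by
    have hb : ∀ᶠ t in nhdsWithin (0 : ℂ) {0}ᶜ, t ∉ bad := by
      have := (hbad.subset (Set.sdiff_subset (t := {0}))).isClosed.isOpen_compl.mem_nhds
        (x := (0 : ℂ)) (by simp)
      filter_upwards [nhdsWithin_le_nhds this, self_mem_nhdsWithin] with t h1 h2 h3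
      exact h1 ⟨h3, h2⟩
    have hz : ∀ᶠ t in nhdsWithin (0 : ℂ) {0}ᶜ, ∀ d : Z, ∀ i, eval (ψ d t) (Q t i) = 0 :=
      Filter.eventually_all.2 fun d => nhdsWithin_le_nhds (hψ2 d)
    have hne : ∀ᶠ t in nhdsWithin (0 : ℂ) {0}ᶜ, ∀ d d' : Z, d ≠ d' → ψ d t ≠ ψ d' t := by
      refine Filter.eventually_all.2 fun d => Filter.eventually_all.2 fun d' => ?_
      by_cases h : d = d'
      · simp [h]
      · filter_upwards [nhdsWithin_le_nhds (((hψ1 d).sub (hψ1 d')).eventually_ne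
          (sub_ne_zero.2 (Subtype.coe_injective.ne h)))] with t ht _
        exact sub_ne_zero.1 ht
    filter_upwards [hb, hz, hne] with t h1 h2 h3
    have hinj : Function.Injective (fun d : Z => ψ d t) := fun d d' h => by
      by_contra hcon
      exact h3 d d' hcon h
    have := gl_ej_generic hn hkN hk (Q t) (Finset.univ.image fun d : Z => ψ d t)
      (by
        intro x hx i
        obtain ⟨d, -, rfl⟩ := Finset.mem_image.1 hx
        exact h2 d i)
      (by rw [Finset.card_image_of_injective _ hinj]; simpa using hcard)
      le_rfl (hgood t h1) g hg
    rw [Finset.sum_image (fun a _ b _ h => hinj h)] at this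
    exact this
  have hfin := tendsto_nhds_unique hlim
    (tendsto_const_nhds.congr' (hzero.mono fun t h => h.symm))
  rw [← hfin, ← Finset.sum_coe_sort Z]

lemma gl_esymm_hom (r m : ℕ) : (esymm (Fin r) ℂ m).IsHomogeneous m := by
  rw [esymm]
  refine IsHomogeneous.sum _ _ _ fun s hs => ?_
  have := IsHomogeneous.prod s (fun i => (X i : MvPolynomial (Fin r) ℂ)) (fun _ => 1)
    (fun i _ => isHomogeneous_X _ _)
  simpa [(Finset.mem_powersetCard.1 hs).2] using this

lemma gl_sym_decomp {r m : ℕ} (S : MvPolynomial (Fin r) ℂ) (hS : S.IsHomogeneous m)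
    (hsym : S.IsSymmetric) :
    ∃ (s : Finset (Fin r →₀ ℕ)) (c : (Fin r →₀ ℕ) → ℂ),
      (∀ a ∈ s, ∑ i, (i.1 + 1) * a i = m) ∧
      S = ∑ a ∈ s, C (c a) * ∏ i, esymm (Fin r) ℂ (i.1 + 1) ^ a i := by
  classical
  obtain ⟨q, hq⟩ := esymmAlgHom_surjective (σ := Fin r) ℂ (n := r) (by simp) ⟨S, hsym⟩
  have hq' : S = ∑ a ∈ q.support, C (coeff a q) * ∏ i, esymm (Fin r) ℂ (i.1 + 1) ^ a i := by
    have := congrArg Subtype.val hq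
    rw [esymmAlgHom_apply, aeval_def, eval₂_eq'] at this
    exact this.symm
  have hhom : ∀ a : Fin r →₀ ℕ, 
      (C (coeff a q) * ∏ i : Fin r, esymm (Fin r) ℂ (i.1 + 1) ^ a i).IsHomogeneous
      (∑ i : Fin r, (i.1 + 1) * a i) := by
    intro a
    have h1 := IsHomogeneous.prod Finset.univ (fun i : Fin r => esymm (Fin r) ℂ (i.1 + 1) ^ a i)
      (fun i => (i.1 + 1) * a i) (fun i _ => (gl_esymm_hom r (i.1 + 1)).pow (a i))
    have h2 := (isHomogeneous_C (Fin r) (coeff a q)).mul h1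
    simpa using h2
  refine ⟨q.support.filter fun a => ∑ i, (i.1 + 1) * a i = m, fun a => coeff a q,
    fun a ha => (Finset.mem_filter.1 ha).2, ?_⟩
  have h3 := congrArg (homogeneousComponent m) hq'
  rw [homogeneousComponent_of_mem hS, if_pos rfl, map_sum] at h3
  rw [h3, Finset.sum_filter]
  refine Finset.sum_congr rfl fun a _ => ?_
  rw [homogeneousComponent_of_mem (hhom a)]
  simp only [eq_comm]

lemma gl_esymm_cons (x : ℂ) (s : Multiset ℂ) (i : ℕ) :
    (x ::ₘ s).esymm (i + 1) = s.esymm (i + 1) + x * s.esymm i := by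
  simp [Multiset.esymm, Multiset.powersetCard_cons, Multiset.map_map,
    Multiset.sum_map_mul_left]

/-- Polynomial Kovalevskaya matrix. -/
noncomputable def glK {n : ℕ} (F : Fin n → MvPolynomial (Fin n) ℂ) :
    Matrix (Fin n) (Fin n) (MvPolynomial (Fin n) ℂ) :=
  (Matrix.of fun i j => pderiv j (F i)) - 1

/-- elementary symmetric functions of the nontrivial exponents, as polynomials -/
noncomputable def glE {n : ℕ} (k : ℕ) (F : Fin n → MvPolynomial (Fin n) ℂ) :
    ℕ → MvPolynomial (Fin n) ℂ
  | 0 => 1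
  | (i + 1) => C ((-1) ^ (i + 1)) * (glK F).charpoly.coeff (n - (i + 1))
      - C ((k : ℂ) - 1) * glE k F i

lemma gl_totalDegree_bind {σ : Type*} {n r m : ℕ} (p : MvPolynomial σ ℂ)
    (hp : p.IsHomogeneous m) (v : σ → MvPolynomial (Fin n) ℂ) (hv : ∀ i, (v i).totalDegree ≤ r) :
    (eval₂Hom C v p).totalDegree ≤ m * r := by
  rw [coe_eval₂Hom, eval₂_eq]
  refine totalDegree_finsetSum_le fun a ha => (totalDegree_mul _ _).trans ?_
  rw [totalDegree_C, zero_add]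
  refine (totalDegree_finsetProd _ _).trans ?_
  calc _ ≤ ∑ i ∈ a.support, a i * r := Finset.sum_le_sum fun i _ =>
        (totalDegree_pow _ _).trans (Nat.mul_le_mul_left _ (hv i))
    _ = m * r := by
      rw [← Finset.sum_mul]
      congr 1
      have := hp (mem_support_iff.1 ha)
      rw [← this, Finsupp.weight_apply]
      simp [Finsupp.sum]

lemma gl_K_degree {n k : ℕ} (F : Fin n → MvPolynomial (Fin n) ℂ)
    (hF : ∀ i, (F i).IsHomogeneous k) (i j : Fin n) : (glK F i j).totalDegree ≤ k - 1 := by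
  rw [glK, Matrix.sub_apply, Matrix.of_apply]
  refine (totalDegree_sub _ _).trans (max_le ?_ ?_)
  · exact (hF i).pderiv.totalDegree_le
  · rw [Matrix.one_apply]
    split_ifs <;> simp

lemma gl_coeff_degree {n k : ℕ} (F : Fin n → MvPolynomial (Fin n) ℂ)
    (hF : ∀ i, (F i).IsHomogeneous k) (i : ℕ) (hi : i ≤ n) :
    ((glK F).charpoly.coeff (n - i)).totalDegree ≤ i * (k - 1) := by
  have h := Matrix.charpoly.univ_coeff_eval₂Hom (R := ℂ) (Fin n) C
    (fun ij : Fin n × Fin n => glK F ij.1 ij.2) (n - i)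
  have h2 : (Matrix.of (Function.curry fun ij : Fin n × Fin n => glK F ij.1 ij.2)) = glK F := rfl
  rw [h2] at h
  rw [← h]
  exact gl_totalDegree_bind _
    (Matrix.charpoly.univ_coeff_isHomogeneous ℂ (Fin n) (n - i) i (by simp; omega)) _
    (fun ij => gl_K_degree F hF _ _)

lemma gl_E_degree {n k : ℕ} (F : Fin n → MvPolynomial (Fin n) ℂ)
    (hF : ∀ i, (F i).IsHomogeneous k) (i : ℕ) (hi : i ≤ n) :
    (glE k F i).totalDegree ≤ i * (k - 1) := by
  induction i with
  | zero => simp [glE]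
  | succ i ih =>
    rw [glE]
    refine (totalDegree_sub _ _).trans (max_le ?_ ?_)
    · refine (totalDegree_mul _ _).trans ?_
      rw [totalDegree_C, zero_add]
      exact gl_coeff_degree F hF (i + 1) hi
    · refine (totalDegree_mul _ _).trans ?_
      rw [totalDegree_C, zero_add]
      exact (ih (by omega)).trans (Nat.mul_le_mul_right _ (by omega))

lemma gl_K_eval {n : ℕ} (F : Fin n → MvPolynomial (Fin n) ℂ) (d : Fin n → ℂ) :
    (glK F).map (eval d) = (Matrix.of fun i j => eval d (pderiv j (F i))) - 1 := by
  ext i j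
  simp only [glK, Matrix.map_apply, Matrix.sub_apply, Matrix.of_apply, map_sub, Matrix.one_apply]
  split_ifs <;> simp

lemma gl_E_eval {n k : ℕ} (F : Fin n → MvPolynomial (Fin n) ℂ) (d : Fin n → ℂ)
    (s : Multiset ℂ)
    (hs : ((Matrix.of fun i j => eval d (pderiv j (F i))) - 1).charpoly.roots
        = ((k : ℂ) - 1) ::ₘ s) (i : ℕ) (hi : i ≤ n) :
    eval d (glE k F i) = s.esymm i := by
  induction i with
  | zero => simp [glE, Multiset.esymm]
  | succ i ih =>
    rw [glE, map_sub, map_mul, map_mul, ih (by omega), eval_C, eval_C, ← Polynomial.coeff_map,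
      ← Matrix.charpoly_map, gl_K_eval]
    set M := (Matrix.of fun i j => eval d (pderiv j (F i))) - 1 with hM
    have hdeg : M.charpoly.natDegree = n := by
      rw [Matrix.charpoly_natDegree_eq_dim]; simp
    have h := Polynomial.coeff_eq_esymm_roots_of_splits (IsAlgClosed.splits M.charpoly)
      (k := n - (i + 1)) (by omega)
    rw [hdeg, (Matrix.charpoly_monic M).leadingCoeff, one_mul, hs,
      show n - (n - (i + 1)) = i + 1 by omega, gl_esymm_cons] at h
    rw [h, ← mul_assoc, ← mul_pow]
    simp

lemma gl_E_zero {n k : ℕ} (hk : 1 < k) (F G : Fin n → MvPolynomial (Fin n) ℂ)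
    (hF : ∀ i, (F i).IsHomogeneous k) (hG : ∀ i, (G i).IsHomogeneous k) (i : ℕ) :
    eval 0 (glE k F i) = eval 0 (glE k G i) := by
  have h0 : ∀ H : Fin n → MvPolynomial (Fin n) ℂ, (∀ i, (H i).IsHomogeneous k) →
      (glK H).map (eval 0) = -1 := by
    intro H hH
    rw [gl_K_eval]
    have : (Matrix.of fun i j => eval (0 : Fin n → ℂ) (pderiv j (H i))) = 0 := by
      ext i j
      rw [Matrix.of_apply, Matrix.zero_apply, eval_zero, constantCoeff_eq]
      exact ((hH i).pderiv (i := j)).coeff_eq_zero (by simp; omega)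
    rw [this, zero_sub]
  induction i with
  | zero => simp [glE]
  | succ i ih =>
    rw [glE, glE, map_sub (eval 0), map_mul, map_mul, map_sub (eval 0), map_mul, map_mul, ih,
      ← Polynomial.coeff_map, ← Polynomial.coeff_map, ← Matrix.charpoly_map,
      ← Matrix.charpoly_map, h0 F hF, h0 G hG]

lemma gl_one_system (n k : ℕ) (hn : 2 ≤ n) (hk : 1 < k)
    (F : Fin n → MvPolynomial (Fin n) ℂ)
    (hF : ∀ i, (F i).IsHomogeneous k)
    (DF : Finset (Fin n → ℂ))
    (hDF : ∀ d, d ∈ DF ↔ d ≠ 0 ∧ ∀ i, eval d (F i) = d i)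
    (hcardF : DF.card = k ^ n - 1)
    (hKF : ∀ d ∈ DF, ((Matrix.of fun i j => eval d (pderiv j (F i))) - 1).det ≠ 0)
    (S : MvPolynomial (Fin (n - 1)) ℂ) (m : ℕ) (hm : m < n)
    (s : Finset (Fin (n - 1) →₀ ℕ)) (c : (Fin (n - 1) →₀ ℕ) → ℂ)
    (hs : ∀ a ∈ s, ∑ i, (i.1 + 1) * a i = m)
    (hS : S = ∑ a ∈ s, C (c a) * ∏ i, esymm (Fin (n - 1)) ℂ (i.1 + 1) ^ a i)
    (ΛF : (Fin n → ℂ) → Fin (n - 1) → ℂ)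
    (hΛF : ∀ d ∈ DF,
      ((Matrix.of fun i j => eval d (pderiv j (F i))) - 1).charpoly.roots
        = ((k : ℂ) - 1) ::ₘ Multiset.map (ΛF d) Finset.univ.val) :
    ∑ d ∈ DF, eval (ΛF d) S / ∏ j, ΛF d j
      = - ((k : ℂ) - 1) * ((∑ a ∈ s, c a * ∏ i : Fin (n - 1), eval 0 (glE k F (i.1 + 1)) ^ a i)
          / (-1) ^ n) := by
  classical
  let g : MvPolynomial (Fin n) ℂ :=
    ∑ a ∈ s, C (c a) * ∏ i : Fin (n - 1), glE k F (i.1 + 1) ^ a i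
  have hk1 : ((k : ℂ) - 1) ≠ 0 := by
    rw [sub_ne_zero]; exact_mod_cast hk.ne'
  have hgd : g.totalDegree < n * (k - 1) := by
    have : g.totalDegree ≤ m * (k - 1) := by
      refine totalDegree_finsetSum_le fun a ha => (totalDegree_mul _ _).trans ?_
      rw [totalDegree_C, zero_add]
      refine (totalDegree_finsetProd _ _).trans ?_
      rw [← hs a ha, Finset.sum_mul]
      refine Finset.sum_le_sum fun i _ => (totalDegree_pow _ _).trans ?_
      calc a i * _ ≤ a i * ((i.1 + 1) * (k - 1)) :=
            Nat.mul_le_mul_left _ (gl_E_degree F hF _ (by omega))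
        _ = _ := by ring
    refine this.trans_lt (Nat.mul_lt_mul_of_pos_right hm (by omega))
  have hge : ∀ d ∈ DF, eval d g = eval (ΛF d) S := by
    intro d hd
    rw [hS]
    simp only [g, map_sum, map_mul, eval_C, map_prod, map_pow]
    refine Finset.sum_congr rfl fun a _ => ?_
    congr 1
    refine Finset.prod_congr rfl fun i _ => ?_
    rw [gl_E_eval F d _ (hΛF d hd) _ (by omega)]
    congr 1
    have := aeval_esymm_eq_multiset_esymm (Fin (n - 1)) ℂ (S := ℂ) (i.1 + 1) (ΛF d)
    rw [← this, aeval_eq_eval]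
  let P : Fin n → MvPolynomial (Fin n) ℂ := fun i => F i - X i
  have hPK : ∀ d, (Matrix.of fun i j => eval d (pderiv j (P i))) =
      (Matrix.of fun i j => eval d (pderiv j (F i))) - 1 := by
    intro d
    ext i j
    by_cases hij : i = j <;> simp [P, pderiv_X, Pi.single_apply, hij]
  have hK0 : (Matrix.of fun i j => eval (0 : Fin n → ℂ) (pderiv j (F i))) = 0 := by
    ext i j
    rw [Matrix.of_apply, Matrix.zero_apply, eval_zero, constantCoeff_eq]
    exact ((hF i).pderiv (i := j)).coeff_eq_zero (by simp; omega)
  have hdet0 : (Matrix.of fun i j => eval (0 : Fin n → ℂ) (pderiv j (P i))).det = (-1) ^ n := by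
    rw [hPK, hK0, zero_sub, Matrix.det_neg]
    simp
  have h0 : (0 : Fin n → ℂ) ∉ DF := fun h => ((hDF 0).1 h).1 rfl
  have hF0 : ∀ i, eval (0 : Fin n → ℂ) (F i) = 0 := fun i => by
    rw [eval_zero, constantCoeff_eq]
    exact (hF i).coeff_eq_zero (by simp; omega)
  have key := gl_euler_jacobi (by omega) (by omega) P
    (fun i => (totalDegree_sub _ _).trans (max_le (hF i).totalDegree_le (by simp; omega)))
    (insert 0 DF)
    (by
      intro d hd i
      rcases Finset.mem_insert.1 hd with rfl | hd
      · have := hF0 i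
        simp only [P, map_sub, eval_X, this]
        simp
      · simp [P, ((hDF d).1 hd).2 i])
    (by
      rw [Finset.card_insert_of_notMem h0, hcardF]
      have : 0 < k ^ n := Nat.pow_pos (by omega)
      omega)
    (by
      intro d hd
      rcases Finset.mem_insert.1 hd with rfl | hd
      · rw [hdet0]; exact pow_ne_zero _ (by norm_num)
      · rw [hPK]; exact hKF d hd)
    g hgd
  rw [Finset.sum_insert h0, hdet0] at key
  have hterm : ∀ d ∈ DF, eval (ΛF d) S / ∏ j, ΛF d j =
      ((k : ℂ) - 1) * (eval d g / (Matrix.of fun i j => eval d (pderiv j (P i))).det) := by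
    intro d hd
    have h := Matrix.det_eq_prod_roots_charpoly
      ((Matrix.of fun i j => eval d (pderiv j (F i))) - 1)
    rw [hΛF d hd, Multiset.prod_cons] at h
    rw [hge d hd, hPK, h, mul_div_assoc', mul_div_mul_left _ _ hk1]
    rfl
  have hg0 : eval 0 g = ∑ a ∈ s, c a * ∏ i : Fin (n - 1), eval 0 (glE k F (i.1 + 1)) ^ a i := by
    simp [g, map_sum, map_prod]
  rw [Finset.sum_congr rfl hterm, ← Finset.mul_sum, ← hg0, eq_neg_of_add_eq_zero_right key]
  ring

/-- Guillot: Let `F, G` be two polynomial maps, all components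
homogeneous of degree `k > 1`, each admitting the maximal number `kⁿ - 1` of
normalized Darboux points, with nonsingular Kovalevskaya matrices there.  For any
symmetric homogeneous polynomial `S` in `n-1` variables of degree `< n`, the sums
`Σ_{Darboux pts} S(Λ(d))/τ_{n-1}(Λ(d))` for `F` and for `G` coincide: the number
`R = R(S,n,k)` does not depend on the system.  Here `Λ(d)` is any tuple listing the
nontrivial Kovalevskaya exponents, i.e. the roots of the characteristic polynomial of
`K(d) = F'(d) - E` with one copy of the trivial exponent `k-1` removed, and
`τ_{n-1}(Λ(d)) = ∏ⱼ Λⱼ(d)`. -/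
theorem guillot_universal_relation
    (n k : ℕ) (hn : 2 ≤ n) (hk : 1 < k)
    (F G : Fin n → MvPolynomial (Fin n) ℂ)
    (hF : ∀ i, (F i).IsHomogeneous k) (hG : ∀ i, (G i).IsHomogeneous k)
    (DF DG : Finset (Fin n → ℂ))
    (hDF : ∀ d, d ∈ DF ↔ d ≠ 0 ∧ ∀ i, eval d (F i) = d i)
    (hDG : ∀ d, d ∈ DG ↔ d ≠ 0 ∧ ∀ i, eval d (G i) = d i)
    (hcardF : DF.card = k ^ n - 1) (hcardG : DG.card = k ^ n - 1)
    (hKF : ∀ d ∈ DF, ((Matrix.of fun i j => eval d (pderiv j (F i))) - 1).det ≠ 0)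
    (hKG : ∀ d ∈ DG, ((Matrix.of fun i j => eval d (pderiv j (G i))) - 1).det ≠ 0)
    (S : MvPolynomial (Fin (n - 1)) ℂ) (m : ℕ) (hm : m < n)
    (hS : S.IsHomogeneous m) (hSsym : S.IsSymmetric)
    (ΛF ΛG : (Fin n → ℂ) → Fin (n - 1) → ℂ)
    (hΛF : ∀ d ∈ DF,
      ((Matrix.of fun i j => eval d (pderiv j (F i))) - 1).charpoly.roots
        = ((k : ℂ) - 1) ::ₘ Multiset.map (ΛF d) Finset.univ.val)
    (hΛG : ∀ d ∈ DG,
      ((Matrix.of fun i j => eval d (pderiv j (G i))) - 1).charpoly.roots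
        = ((k : ℂ) - 1) ::ₘ Multiset.map (ΛG d) Finset.univ.val) :
    ∑ d ∈ DF, eval (ΛF d) S / ∏ j, ΛF d j
      = ∑ d ∈ DG, eval (ΛG d) S / ∏ j, ΛG d j := by

  obtain ⟨s, c, hs, hSe⟩ := gl_sym_decomp S hS hSsym
  rw [gl_one_system n k hn hk F hF DF hDF hcardF hKF S m hm s c hs hSe ΛF hΛF,
    gl_one_system n k hn hk G hG DG hDG hcardG hKG S m hm s c hs hSe ΛG hΛG]
  simp only [gl_E_zero hk F G hF hG]
end

section
/- Fix n ≥ 1 and an integer k > 2, and identify the space 𝓗_k of homogeneous polynomials of degree k in q₁,…,q_n over ℂ with ℂ^N, N = C(n+k−1, k), via coefficients. Let 𝓖_k ⊂ 𝓗_k be the set of potentials V such that (1) the set {d ∈ ℂⁿ \ {0} : V'(d) = d} has exactly (k−1)ⁿ − 1 elements (the maximal number), and (2) at each such d the Kovalevskaya matrix V''(d) − E is nonsingular (all Kovalevskaya exponents nonzero). Then 𝓖_k is open (in the standard topology of ℂ^N) and nonempty. -/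
open MvPolynomial

/-- The coefficient index set of the space `𝓗_k` of homogeneous polynomials of degree
`k` in `n` variables: exponent multi-indices of total degree `k`.  It has exactly
`N = C(n+k-1, k)` elements, so `↥(expSet n k) → ℂ` is a copy of `ℂ^N` (carrying the
standard product topology), and `c ↦ polyOfCoeffs n k c` below is the coefficient
identification of `ℂ^N` with `𝓗_k`. -/
def expSet (n k : ℕ) : Finset (Fin n →₀ ℕ) :=
  Finset.finsuppAntidiag (Finset.univ : Finset (Fin n)) k

/-- The homogeneous polynomial of degree `k` with coefficient vector `c`. -/
noncomputable def polyOfCoeffs (n k : ℕ) (c : expSet n k → ℂ) : MvPolynomial (Fin n) ℂ :=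
  ∑ m : expSet n k, monomial (m : Fin n →₀ ℕ) (c m)

/-- The Kovalevskaya matrix `K(d) = V''(d) - E` of a potential `V` at a point `d`. -/
noncomputable def kovMatrix {n : ℕ} (V : MvPolynomial (Fin n) ℂ) (d : Fin n → ℂ) :
    Matrix (Fin n) (Fin n) ℂ :=
  (Matrix.of fun i j => eval d (pderiv i (pderiv j V))) - 1

/-- The set `𝓖_k ⊂ 𝓗_k ≅ ℂ^N` of potentials `V` having the maximal number
`(k-1)ⁿ - 1` of normalized Darboux points `V'(d) = d`, with all Kovalevskaya exponents
nonzero (i.e. `K(d) = V''(d) - E` nonsingular) at each of them. -/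
noncomputable def genericSet (n k : ℕ) : Set (expSet n k → ℂ) :=
  {c | Set.ncard {d : Fin n → ℂ | d ≠ 0 ∧
          ∀ i, eval d (pderiv i (polyOfCoeffs n k c)) = d i} = (k - 1) ^ n - 1 ∧
       ∀ d : Fin n → ℂ, d ≠ 0 → (∀ i, eval d (pderiv i (polyOfCoeffs n k c)) = d i) →
         (kovMatrix (polyOfCoeffs n k c) d).det ≠ 0}


/-- Jacobian matrix. -/
noncomputable def jacM {n : ℕ} (F : Fin n → MvPolynomial (Fin n) ℂ) (x : Fin n → ℂ) :
    Matrix (Fin n) (Fin n) ℂ :=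
  Matrix.of fun i j => eval x (pderiv j (F i))

lemma hasFDerivAt_evalPoly {n : ℕ} (p : MvPolynomial (Fin n) ℂ) (x : Fin n → ℂ) :
    HasFDerivAt (fun y : Fin n → ℂ => eval y p)
      (∑ j, eval x (pderiv j p) • (ContinuousLinearMap.proj j : (Fin n → ℂ) →L[ℂ] ℂ)) x := by
  induction p using MvPolynomial.induction_on with
  | C a =>
    simp only [eval_C, pderiv_C, map_zero]
    refine (hasFDerivAt_const a x).congr_fderiv ?_
    ext v
    simp
  | add p q hp hq =>
    have h := hp.add hq
    have h2 : (fun y : Fin n → ℂ => eval y (p + q)) =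
        (fun y => eval y p) + (fun y => eval y q) := by
      funext y; simp
    rw [h2]
    refine h.congr_fderiv ?_
    ext v
    simp [add_mul, Finset.sum_add_distrib]
  | mul_X p i hp =>
    have h1 : HasFDerivAt (fun y : Fin n → ℂ => y i)
        (ContinuousLinearMap.proj i : (Fin n → ℂ) →L[ℂ] ℂ) x :=
      (ContinuousLinearMap.proj i : (Fin n → ℂ) →L[ℂ] ℂ).hasFDerivAt
    have h2 := hp.mul h1
    simp only [map_mul, eval_X]
    refine h2.congr_fderiv ?_
    ext v
    simp only [Derivation.leibniz, pderiv_X, smul_eq_mul, map_add, map_mul, eval_X,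
      _root_.add_apply, _root_.smul_apply,
      _root_.sum_apply, ContinuousLinearMap.proj_apply, add_mul,
      Finset.sum_add_distrib, Finset.mul_sum]
    congr 1
    · rw [Finset.sum_eq_single i]
      · simp
      · intro b _ hb
        simp [hb]
      · simp
    · exact Finset.sum_congr rfl fun j _ => by ring

open Filter Topology in
lemma persist_one {n : ℕ} {E : Type*} [NormedAddCommGroup E] [NormedSpace ℂ E] [CompleteSpace E]
    (F : E → Fin n → MvPolynomial (Fin n) ℂ)
    (hF : ∀ i, ContDiff ℂ 1 (fun z : E × (Fin n → ℂ) => eval z.2 (F z.1 i)))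
    (e₀ : E) (p : Fin n → ℂ) (hp : ∀ i, eval p (F e₀ i) = 0) (hd : (jacM (F e₀) p).det ≠ 0)
    (U : Set (Fin n → ℂ)) (hU : U ∈ 𝓝 p) :
    ∀ᶠ e in 𝓝 e₀, ∃ x ∈ U, (∀ i, eval x (F e i) = 0) ∧ (jacM (F e) x).det ≠ 0 := by
  set f : Fin n → E × (Fin n → ℂ) → ℂ := fun i z => eval z.2 (F z.1 i) with hf
  have hjac : ∀ e x i j, jacM (F e) x i j = fderiv ℂ (f i) (e, x) (0, Pi.single j 1) := by
    intro e x i j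
    have h1 : HasFDerivAt (f i) (fderiv ℂ (f i) (e, x)) (e, x) :=
      ((hF i).differentiable (by simp) _).hasFDerivAt
    have h2 : HasFDerivAt (fun y : Fin n → ℂ => (e, y)) (ContinuousLinearMap.inr ℂ E (Fin n → ℂ)) x :=
      hasFDerivAt_prodMk_right e x
    have h3 := h1.comp x h2
    have h4 := h3.unique (hasFDerivAt_evalPoly (F e i) x)
    have h5 := congrArg (fun L => L (Pi.single j (1:ℂ))) h4
    simp only [ContinuousLinearMap.comp_apply, ContinuousLinearMap.inr_apply,
      _root_.sum_apply, _root_.smul_apply,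
      ContinuousLinearMap.proj_apply, smul_eq_mul] at h5
    rw [h5, Finset.sum_eq_single j]
    · simp [jacM]
    · intro b _ hb
      simp [hb]
    · simp
  have hcont : Continuous fun z : E × (Fin n → ℂ) => (jacM (F z.1) z.2).det := by
    apply Continuous.matrix_det
    refine continuous_pi fun i => continuous_pi fun j => ?_
    have : (fun z : E × (Fin n → ℂ) => jacM (F z.1) z.2 i j) =
        fun z => fderiv ℂ (f i) z (0, Pi.single j 1) := by
      funext z; exact hjac _ _ _ _
    rw [this]
    exact ((hF i).continuous_fderiv (by simp)).clm_apply continuous_const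
  set Ψ : E × (Fin n → ℂ) → E × (Fin n → ℂ) := fun z => (z.1, fun i => f i z) with hΨ
  have hstrict : HasStrictFDerivAt Ψ
      ((ContinuousLinearMap.fst ℂ E (Fin n → ℂ)).prod
        (ContinuousLinearMap.pi fun i => fderiv ℂ (f i) (e₀, p))) (e₀, p) := by
    apply HasStrictFDerivAt.prodMk
    · exact hasStrictFDerivAt_fst
    · rw [hasStrictFDerivAt_pi]
      intro i
      exact (hF i).contDiffAt.hasStrictFDerivAt (by simp)
  have hlin : ∀ (i : Fin n) (a : E) (b : Fin n → ℂ), fderiv ℂ (f i) (e₀, p) (a, b) =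
      fderiv ℂ (f i) (e₀, p) (a, 0) + (jacM (F e₀) p).mulVec b i := by
    intro i a b
    have : (a, b) = (a, (0 : Fin n → ℂ)) + ∑ j, b j • ((0 : E), Pi.single j (1:ℂ)) := by
      ext
      · simp [Prod.fst_sum]
      · simp [Prod.snd_sum, Finset.sum_apply, Pi.single_apply]
    rw [this, map_add, map_sum]
    simp only [map_smul, ← hjac, Matrix.mulVec, dotProduct, smul_eq_mul]
    congr 1
    exact Finset.sum_congr rfl fun j _ => mul_comm _ _
  have hsurj := hstrict.map_nhds_eq_of_surj (by
    rw [LinearMap.range_eq_top]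
    rintro ⟨a, y⟩
    set y' : Fin n → ℂ := fun i => y i - fderiv ℂ (f i) (e₀, p) (a, 0)
    refine ⟨(a, (jacM (F e₀) p)⁻¹.mulVec y'), ?_⟩
    ext i
    · simp
    · have : (jacM (F e₀) p).mulVec ((jacM (F e₀) p)⁻¹.mulVec y') = y' := by
        rw [Matrix.mulVec_mulVec, Matrix.mul_nonsing_inv _ (isUnit_iff_ne_zero.mpr hd),
          Matrix.one_mulVec]
      have h2 := hlin i a ((jacM (F e₀) p)⁻¹.mulVec y')
      rw [this] at h2
      simp only [ContinuousLinearMap.coe_coe, ContinuousLinearMap.prod_apply,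
        ContinuousLinearMap.pi_apply, h2, y']
      ring)
  have hmem : {z : E × (Fin n → ℂ) | z.2 ∈ U ∧ (jacM (F z.1) z.2).det ≠ 0} ∈ 𝓝 (e₀, p) := by
    apply Filter.inter_mem
    · exact (continuous_snd.tendsto (e₀, p)) hU
    · exact hcont.continuousAt.eventually_ne hd
  have himg := image_mem_map (m := Ψ) hmem
  rw [hsurj] at himg
  have h0 : Ψ (e₀, p) = (e₀, 0) := by
    simp only [hΨ, hf, Prod.mk.injEq, true_and]
    funext i; exact hp i
  rw [h0] at himg
  have hc : Tendsto (fun e : E => (e, (0 : Fin n → ℂ))) (𝓝 e₀) (𝓝 (e₀, 0)) :=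
    (Continuous.prodMk_left (0 : Fin n → ℂ)).tendsto e₀
  filter_upwards [hc himg] with e he
  obtain ⟨⟨e', x⟩, ⟨hxU, hxd⟩, hx⟩ := he
  simp only [hΨ, Prod.mk.injEq] at hx
  obtain ⟨rfl, hx2⟩ := hx
  exact ⟨x, hxU, fun i => congrFun hx2 i, hxd⟩

open Filter Topology in
lemma persist {n : ℕ} {E : Type*} [NormedAddCommGroup E] [NormedSpace ℂ E] [CompleteSpace E]
    (F : E → Fin n → MvPolynomial (Fin n) ℂ)
    (hF : ∀ i, ContDiff ℂ 1 (fun z : E × (Fin n → ℂ) => eval z.2 (F z.1 i)))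
    (e₀ : E) (S : Finset (Fin n → ℂ)) (hS : ∀ p ∈ S, ∀ i, eval p (F e₀ i) = 0)
    (hd : ∀ p ∈ S, (jacM (F e₀) p).det ≠ 0)
    (V : Set (Fin n → ℂ)) (hV : IsOpen V) (hSV : ∀ p ∈ S, p ∈ V) :
    ∀ᶠ e in 𝓝 e₀, ∃ T : Finset (Fin n → ℂ), T.card = S.card ∧ ∀ x ∈ T,
      x ∈ V ∧ (∀ i, eval x (F e i) = 0) ∧ (jacM (F e) x).det ≠ 0 := by
  classical
  obtain ⟨U, hU, hdisj⟩ := S.finite_toSet.t2_separation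
  have h1 : ∀ᶠ e in 𝓝 e₀, ∀ p ∈ S, ∃ x ∈ U p ∩ V,
      (∀ i, eval x (F e i) = 0) ∧ (jacM (F e) x).det ≠ 0 := by
    rw [Filter.eventually_all_finset]
    intro p hp
    exact persist_one F hF e₀ p (hS p hp) (hd p hp) _
      (((hU p).2.inter hV).mem_nhds ⟨(hU p).1, hSV p hp⟩)
  filter_upwards [h1] with e he
  choose! g hg using he
  refine ⟨S.image g, ?_, ?_⟩
  · apply Finset.card_image_of_injOn
    intro p hp q hq hpq
    by_contra hne
    have hgp := (hg p hp).1.1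
    have hgq := (hg q hq).1.1
    rw [← hpq] at hgq
    exact Set.disjoint_left.mp (hdisj hp hq hne) hgp hgq
  · intro x hx
    obtain ⟨p, hp, rfl⟩ := Finset.mem_image.mp hx
    exact ⟨(hg p hp).1.2, (hg p hp).2⟩

lemma generic_bound (n m D : ℕ) (F : Fin n → MvPolynomial (Fin n) ℂ)
    (hdeg : ∀ i, (F i).totalDegree ≤ m) :
    ∃ Q : Polynomial ℂ, Q ≠ 0 ∧ ∀ s : ℂ, Q.eval s ≠ 0 → ∀ Z : Finset (Fin n → ℂ),
      Z.card ≤ D → (∀ z ∈ Z, ∀ i, eval z (C s * F i + C (1 - s) * X i ^ m) = 0) →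
      Z.card ≤ m ^ n := by
  classical
  obtain ⟨N, hN⟩ : ∃ N : Finset (Fin n →₀ ℕ), ∀ μ, μ ∈ N ↔ μ.degree ≤ D ∧ ∃ i, m ≤ μ i := by
    refine ⟨((Finset.range (D + 1)).biUnion
      (Finset.finsuppAntidiag (Finset.univ : Finset (Fin n)))).filter
        (fun μ => ∃ i, m ≤ μ i), fun μ => ?_⟩
    simp [Finsupp.degree_eq_sum]
  have hch : ∀ μ : N, ∃ i, m ≤ (μ : Fin n →₀ ℕ) i := fun μ => ((hN _).1 μ.2).2
  choose idx hidx using hch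
  set mon : N → MvPolynomial (Fin n) ℂ := fun μ =>
    monomial ((μ : Fin n →₀ ℕ) - Finsupp.single (idx μ) m) 1 with hmon
  have hmonX : ∀ μ : N, mon μ * X (idx μ) ^ m = monomial (μ : Fin n →₀ ℕ) 1 := by
    intro μ
    rw [hmon, X_pow_eq_monomial, monomial_mul, one_mul, tsub_add_cancel_of_le]
    rw [Finsupp.single_le_iff]
    exact hidx μ
  have hmondeg : ∀ μ : N, (mon μ).totalDegree + m ≤ D := by
    intro μ
    have h1 : (mon μ).totalDegree ≤ ((μ : Fin n →₀ ℕ) - Finsupp.single (idx μ) m).degree := by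
      have := totalDegree_monomial_le (R := ℂ) ((μ : Fin n →₀ ℕ) - Finsupp.single (idx μ) m) 1
      exact this
    have h2 : ((μ : Fin n →₀ ℕ) - Finsupp.single (idx μ) m).degree + m =
        (μ : Fin n →₀ ℕ).degree := by
      have h3 : ((μ : Fin n →₀ ℕ) - Finsupp.single (idx μ) m) + Finsupp.single (idx μ) m = μ := by
        rw [tsub_add_cancel_of_le]
        rw [Finsupp.single_le_iff]
        exact hidx μ
      conv_rhs => rw [← h3]
      rw [map_add, Finsupp.degree_single]
    have h4 := ((hN _).1 μ.2).1
    omega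
  set A : Matrix N N (Polynomial ℂ) := Matrix.of fun μ ν =>
    Polynomial.C (coeff (ν : Fin n →₀ ℕ) (mon μ * F (idx μ))) * Polynomial.X +
    Polynomial.C (coeff (ν : Fin n →₀ ℕ) (mon μ * X (idx μ) ^ m)) * (1 - Polynomial.X) with hA
  have hAe : ∀ s, Polynomial.eval s A.det =
      (Matrix.of fun μ ν : N => coeff (ν : Fin n →₀ ℕ)
        (mon μ * (C s * F (idx μ) + C (1 - s) * X (idx μ) ^ m))).det := by
    intro s
    rw [← Polynomial.coe_evalRingHom, RingHom.map_det]
    congr 1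
    ext μ ν
    have : mon μ * (C s * F (idx μ) + C (1 - s) * X (idx μ) ^ m) =
      C s * (mon μ * F (idx μ)) + C (1 - s) * (mon μ * X (idx μ) ^ m) := by ring
    simp only [hA, RingHom.mapMatrix_apply, Matrix.map_apply, Matrix.of_apply, this, coeff_add,
      coeff_C_mul]
    simp
    ring
  refine ⟨A.det, ?_, ?_⟩
  · intro h0
    have h1 := hAe 0
    rw [h0] at h1
    have h2 : (Matrix.of fun μ ν : N => coeff (ν : Fin n →₀ ℕ)
        (mon μ * (C 0 * F (idx μ) + C (1 - 0) * X (idx μ) ^ m))) = (1 : Matrix N N ℂ) := by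
      ext μ ν
      simp only [Matrix.of_apply, map_zero, zero_mul, zero_add, sub_zero, map_one, one_mul, hmonX,
        coeff_monomial, Matrix.one_apply, Subtype.ext_iff]
    rw [h2] at h1
    simp at h1
  intro s hs Z hZD hZ
  by_contra hlt
  push Not at hlt
  rw [hAe] at hs
  let ev : (Z → ℂ) →ₗ[ℂ] ((Fin n → Fin m) → ℂ) :=
    LinearMap.pi fun β => ∑ z : Z, (∏ j, (z : Fin n → ℂ) j ^ (β j : ℕ)) • LinearMap.proj z
  have hker : ev.ker ≠ ⊥ := by
    apply LinearMap.ker_ne_bot_of_finrank_lt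
    simpa using hlt
  obtain ⟨w, hw, hw0⟩ := Submodule.exists_mem_ne_zero_of_ne_bot hker
  let L : MvPolynomial (Fin n) ℂ →ₗ[ℂ] ℂ :=
    ∑ z : Z, w z • (aeval (z : Fin n → ℂ) : MvPolynomial (Fin n) ℂ →ₐ[ℂ] ℂ).toLinearMap
  have hL : ∀ p, L p = ∑ z : Z, w z * eval (z : Fin n → ℂ) p := by
    intro p
    simp [L, aeval_eq_eval]
  have hB : ∀ ν : Fin n →₀ ℕ, (∀ i, ν i < m) → L (monomial ν 1) = 0 := by
    intro ν hν
    rw [LinearMap.mem_ker] at hw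
    have h1 := congrFun hw (fun i => ⟨ν i, hν i⟩)
    simp only [ev, LinearMap.pi_apply, LinearMap.sum_apply, LinearMap.smul_apply,
      LinearMap.proj_apply, smul_eq_mul, Pi.zero_apply] at h1
    rw [hL, ← h1]
    refine Finset.sum_congr rfl fun z _ => ?_
    rw [eval_monomial, one_mul, Finsupp.prod_fintype _ _ (by simp), mul_comm]
  have hLexp : ∀ p : MvPolynomial (Fin n) ℂ, p.totalDegree ≤ D →
      L p = ∑ ν : N, coeff (ν : Fin n →₀ ℕ) p * L (monomial (ν : Fin n →₀ ℕ) 1) := by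
    intro p hp
    have h1 : L p = ∑ ν ∈ p.support, coeff ν p * L (monomial ν 1) := by
      conv_lhs => rw [p.as_sum, map_sum]
      refine Finset.sum_congr rfl fun ν _ => ?_
      rw [← smul_eq_mul, ← map_smul, smul_monomial, smul_eq_mul, mul_one]
    rw [h1, Finset.sum_coe_sort N (fun ν => coeff ν p * L (monomial ν 1))]
    rw [Finset.sum_subset (Finset.subset_union_left (s₁ := p.support) (s₂ := N)),
      Finset.sum_subset (Finset.subset_union_right (s₁ := p.support) (s₂ := N))]
    · intro ν hν hνN
      have hνs : ν ∈ p.support := by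
        rcases Finset.mem_union.1 hν with h | h
        · exact h
        · exact absurd h hνN
      have hd : ν.degree ≤ D := (le_totalDegree hνs).trans hp
      rw [hB ν, mul_zero]
      intro i
      by_contra hi
      exact hνN ((hN ν).2 ⟨hd, i, not_lt.1 hi⟩)
    · intro ν _ hν
      rw [notMem_support_iff.1 hν, zero_mul]
  have hGdeg : ∀ i, (C s * F i + C (1 - s) * X i ^ m : MvPolynomial (Fin n) ℂ).totalDegree ≤ m := by
    intro i
    refine (totalDegree_add _ _).trans (max_le ?_ ?_)
    · refine (totalDegree_mul _ _).trans ?_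
      simpa using hdeg i
    · refine (totalDegree_mul _ _).trans ?_
      rw [totalDegree_C, zero_add, totalDegree_X_pow]
  have hl : (fun ν : N => L (monomial (ν : Fin n →₀ ℕ) 1)) = 0 := by
    refine Matrix.eq_zero_of_mulVec_eq_zero hs ?_
    funext μ
    have h1 := hLexp (mon μ * (C s * F (idx μ) + C (1 - s) * X (idx μ) ^ m))
      ((totalDegree_mul _ _).trans ((Nat.add_le_add_left (hGdeg _) _).trans (hmondeg μ)))
    simp only [Matrix.mulVec, dotProduct, Matrix.of_apply, Pi.zero_apply]
    rw [← h1, hL]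
    refine Finset.sum_eq_zero fun z _ => ?_
    rw [map_mul, hZ z z.2, mul_zero, mul_zero]
  have hLD : ∀ p : MvPolynomial (Fin n) ℂ, p.totalDegree ≤ D → L p = 0 := by
    intro p hp
    rw [hLexp p hp]
    refine Finset.sum_eq_zero fun ν _ => ?_
    rw [show L (monomial (ν : Fin n →₀ ℕ) 1) = 0 from congrFun hl ν, mul_zero]
  apply hw0
  funext z
  have hsep : ∀ y : Fin n → ℂ, ∃ j, y ≠ z → (z : Fin n → ℂ) j ≠ y j := by
    intro y
    by_cases h : y = z
    · by_cases hn : Nonempty (Fin n)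
      · exact ⟨hn.some, fun h' => absurd h h'⟩
      · exfalso
        have : Z.card ≤ 1 := Finset.card_le_one.2 fun a _ b _ => by
          funext i; exact absurd ⟨i⟩ hn
        have hn0 : n = 0 := by
          by_contra h0
          exact hn ⟨⟨0, Nat.pos_of_ne_zero h0⟩⟩
        subst hn0
        simp at hlt
        omega
    · obtain ⟨j, hj⟩ := Function.ne_iff.1 h
      exact ⟨j, fun _ h' => hj h'.symm⟩
  choose jj hjj using hsep
  have h1 := hLD (∏ y ∈ Z.erase z, (X (jj y) - C (y (jj y)))) (by
    refine (totalDegree_finsetProd _ _).trans ?_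
    refine (Finset.sum_le_card_nsmul _ _ 1 ?_).trans ?_
    · intro y _
      refine (totalDegree_sub _ _).trans ?_
      simp
    · simp only [smul_eq_mul, mul_one]
      exact Finset.card_erase_le.trans hZD)
  rw [hL, Finset.sum_eq_single z] at h1
  · rcases mul_eq_zero.1 h1 with h | h
    · exact h
    · exfalso
      rw [map_prod, Finset.prod_eq_zero_iff] at h
      obtain ⟨y, hy, hy0⟩ := h
      have := hjj y (Finset.ne_of_mem_erase hy)
      simp only [map_sub, eval_X, eval_C, sub_eq_zero] at hy0
      exact this hy0
  · intro y _ hy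
    rw [map_prod, Finset.prod_eq_zero (i := (y : Fin n → ℂ)), mul_zero]
    · exact Finset.mem_erase.2 ⟨fun h => hy (Subtype.ext h), y.2⟩
    · simp
  · simp

open Filter Topology in
lemma poly_ne_zero_punctured (Q : Polynomial ℂ) (hQ : Q ≠ 0) (a : ℂ) :
    ∀ᶠ s in 𝓝[≠] a, Q.eval s ≠ 0 := by
  have hfin : {s | Q.eval s = 0}.Finite := by
    refine Q.roots.toFinset.finite_toSet.subset fun s hs => ?_
    simpa [hQ] using hs
  have h := (hfin.subset (Set.sdiff_subset (t := {a}))).isClosed.isOpen_compl.mem_nhds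
    (x := a) (by simp)
  filter_upwards [mem_nhdsWithin_of_mem_nhds h, self_mem_nhdsWithin] with s hs hsa h0
  exact hs ⟨h0, hsa⟩

lemma contDiff_evalPoly {n : ℕ} (p : MvPolynomial (Fin n) ℂ) :
    ContDiff ℂ 1 (fun y : Fin n → ℂ => eval y p) := by
  induction p using MvPolynomial.induction_on with
  | C a => simpa using contDiff_const
  | add p q hp hq => simpa using hp.add hq
  | mul_X p i hp => simpa using hp.mul (contDiff_apply ℂ ℂ i)

open Filter Topology in
lemma bezout_le (n m : ℕ) (F : Fin n → MvPolynomial (Fin n) ℂ)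
    (hdeg : ∀ i, (F i).totalDegree ≤ m) (S : Finset (Fin n → ℂ))
    (hS : ∀ p ∈ S, ∀ i, eval p (F i) = 0) (hd : ∀ p ∈ S, (jacM F p).det ≠ 0) :
    S.card ≤ m ^ n := by
  obtain ⟨Q, hQ, hb⟩ := generic_bound n m S.card F hdeg
  have h1 := persist (fun (s : ℂ) i => C s * F i + C (1 - s) * X i ^ m) (by
      intro i
      simp only [map_add, map_mul, eval_C, map_pow, eval_X]
      refine ContDiff.add (contDiff_fst.mul ((contDiff_evalPoly (F i)).comp contDiff_snd))
        ((contDiff_const.sub contDiff_fst).mul ?_)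
      exact ((contDiff_apply ℂ ℂ i).comp contDiff_snd).pow m) 1 S
    (by simpa using hS) (by simpa using hd) Set.univ isOpen_univ (by simp)
  obtain ⟨s, ⟨T, hT, hTz⟩, hs⟩ :=
    ((h1.filter_mono nhdsWithin_le_nhds).and (poly_ne_zero_punctured Q hQ 1)).exists
  rw [← hT]
  exact hb s hs T hT.le fun z hz => (hTz z hz).2.1

open Filter Topology in
lemma bezout_max (n m : ℕ) (hm : 1 ≤ m) (F : Fin n → MvPolynomial (Fin n) ℂ)
    (hdeg : ∀ i, (F i).totalDegree ≤ m) (S : Finset (Fin n → ℂ))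
    (hS : ∀ p ∈ S, ∀ i, eval p (F i) = 0) (hd : ∀ p ∈ S, (jacM F p).det ≠ 0)
    (hcard : S.card = m ^ n) (q : Fin n → ℂ) (hq : ∀ i, eval q (F i) = 0) : q ∈ S := by
  classical
  by_contra hqS
  have h1 := persist (fun (s : ℂ) i => F i + C s * (X i - C (q i))) (by
      intro i
      simp only [map_add, map_mul, eval_C, map_sub, eval_X]
      refine ContDiff.add ((contDiff_evalPoly (F i)).comp contDiff_snd)
        (contDiff_fst.mul (ContDiff.sub ?_ contDiff_const))
      exact ((contDiff_apply ℂ ℂ i).comp contDiff_snd)) 0 S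
    (by simpa using hS) (by simpa using hd) {q}ᶜ isOpen_compl_singleton
    (by intro p hp h; exact hqS (h ▸ hp))
  obtain ⟨s, ⟨T, hT, hTz⟩, hs⟩ :=
    ((h1.filter_mono nhdsWithin_le_nhds).and (poly_ne_zero_punctured (-jacM F q).charpoly
      (Matrix.charpoly_monic _).ne_zero 0)).exists
  have h2 := bezout_le n m (fun i => F i + C s * (X i - C (q i))) (by
    intro i
    refine (totalDegree_add _ _).trans (max_le (hdeg i) ?_)
    refine (totalDegree_mul _ _).trans ?_
    rw [totalDegree_C, zero_add]
    refine (totalDegree_sub _ _).trans ?_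
    simpa using hm) (insert q T) (by
      intro p hp
      rcases Finset.mem_insert.1 hp with rfl | hp
      · simpa using hq
      · exact (hTz p hp).2.1) (by
      intro p hp
      rcases Finset.mem_insert.1 hp with rfl | hp
      · rw [Matrix.eval_charpoly] at hs
        convert hs using 2
        ext i j
        simp only [jacM, Matrix.of_apply, map_add, map_sub, Derivation.leibniz, pderiv_X, pderiv_C,
          Matrix.sub_apply, Matrix.neg_apply, Matrix.scalar_apply, Matrix.diagonal_apply]
        by_cases hij : i = j
        · subst hij; simp; ring
        · simp [hij]
      · exact (hTz p hp).2.2)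
  rw [Finset.card_insert_of_notMem, hT, hcard] at h2
  · omega
  · intro hqT
    exact (hTz q hqT).1 rfl

lemma polyOfCoeffs_isHomogeneous (n k : ℕ) (c : expSet n k → ℂ) :
    (polyOfCoeffs n k c).IsHomogeneous k := by
  refine IsHomogeneous.sum _ _ _ fun m _ => isHomogeneous_monomial _ ?_
  have := m.2
  simp only [expSet, Finset.mem_finsuppAntidiag] at this
  rw [Finsupp.degree_eq_sum]
  exact this.1

lemma eval_zero_of_isHomogeneous {n k : ℕ} (hk : k ≠ 0) {p : MvPolynomial (Fin n) ℂ}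
    (hp : p.IsHomogeneous k) : eval 0 p = 0 := by
  have h := hp.coeff_eq_zero (d := 0) (by simpa using hk.symm)
  rw [← constantCoeff_eq] at h
  rw [← h, ← eval_zero]

/-- The system `V'(d) - d`. -/
noncomputable def darbouxSys (n k : ℕ) (c : expSet n k → ℂ) (i : Fin n) :
    MvPolynomial (Fin n) ℂ :=
  pderiv i (polyOfCoeffs n k c) - X i

lemma jacM_darbouxSys (n k : ℕ) (c : expSet n k → ℂ) (d : Fin n → ℂ) :
    (jacM (darbouxSys n k c) d).det = (kovMatrix (polyOfCoeffs n k c) d).det := by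
  rw [← Matrix.det_transpose]
  congr 1
  ext i j
  by_cases h : i = j
  · subst h
    simp [jacM, darbouxSys, kovMatrix]
  · simp [jacM, darbouxSys, kovMatrix, h, Ne.symm h, Pi.single_apply]

lemma darbouxSys_eval (n k : ℕ) (c : expSet n k → ℂ) (d : Fin n → ℂ) (i : Fin n) :
    eval d (darbouxSys n k c i) = 0 ↔ eval d (pderiv i (polyOfCoeffs n k c)) = d i := by
  simp [darbouxSys, sub_eq_zero]

lemma kov_zero (n k : ℕ) (hk : 2 < k) (c : expSet n k → ℂ) :
    (kovMatrix (polyOfCoeffs n k c) 0).det ≠ 0 := by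
  have : kovMatrix (polyOfCoeffs n k c) 0 = -1 := by
    ext i j
    have h := eval_zero_of_isHomogeneous (by omega)
      (((polyOfCoeffs_isHomogeneous n k c).pderiv (i := j)).pderiv (i := i))
    simp only [kovMatrix, Matrix.sub_apply, Matrix.of_apply, h, Matrix.neg_apply, zero_sub]
  rw [this, Matrix.det_neg]
  simp

lemma grad_zero (n k : ℕ) (hk : 2 < k) (c : expSet n k → ℂ) (i : Fin n) :
    eval 0 (pderiv i (polyOfCoeffs n k c)) = 0 :=
  eval_zero_of_isHomogeneous (by omega) ((polyOfCoeffs_isHomogeneous n k c).pderiv (i := i))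

open Filter Topology in
lemma genericSet_isOpen (n k : ℕ) (hn : 1 ≤ n) (hk : 2 < k) : IsOpen (genericSet n k) := by
  classical
  rw [isOpen_iff_eventually]
  rintro c₀ ⟨hcard, hdet⟩
  have hpow : 1 < (k - 1) ^ n := Nat.one_lt_pow (by omega) (by omega)
  have hfin := Set.finite_of_ncard_ne_zero (by rw [hcard]; omega)
  set S₀ := hfin.toFinset with hS₀
  have hS₀c : S₀.card = (k - 1) ^ n - 1 := by
    rw [← hcard, Set.ncard_eq_toFinset_card _ hfin]
  have h0 : (0 : Fin n → ℂ) ∉ S₀ := by simp [hS₀]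
  have hS : (insert 0 S₀).card = (k - 1) ^ n := by
    rw [Finset.card_insert_of_notMem h0, hS₀c]; omega
  have h1 := persist (fun c => darbouxSys n k c) (by
      intro i
      simp only [darbouxSys, polyOfCoeffs, map_sub, map_sum, eval_X]
      refine ContDiff.sub (ContDiff.sum fun m _ => ?_)
        ((contDiff_apply ℂ ℂ i).comp contDiff_snd)
      have : (fun z : (expSet n k → ℂ) × (Fin n → ℂ) =>
          eval z.2 (pderiv i (monomial (m : Fin n →₀ ℕ) (z.1 m)))) =
          fun z => z.1 m * eval z.2 (pderiv i (monomial (m : Fin n →₀ ℕ) 1)) := by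
        funext z
        rw [← mul_one (z.1 m), ← smul_eq_mul, ← smul_monomial, Derivation.map_smul, smul_eval, smul_eq_mul,
          mul_one]
      rw [this]
      exact ((contDiff_apply ℂ ℂ m).comp contDiff_fst).mul
        ((contDiff_evalPoly _).comp contDiff_snd)) c₀ (insert 0 S₀)
    (by
      intro p hp i
      rw [darbouxSys_eval]
      rcases Finset.mem_insert.1 hp with rfl | hp
      · exact grad_zero n k hk c₀ i
      · rw [hS₀, Set.Finite.mem_toFinset] at hp
        exact hp.2 i)
    (by
      intro p hp
      rw [jacM_darbouxSys]
      rcases Finset.mem_insert.1 hp with rfl | hp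
      · exact kov_zero n k hk c₀
      · rw [hS₀, Set.Finite.mem_toFinset] at hp
        exact hdet p hp.1 hp.2) Set.univ isOpen_univ (by simp)
  filter_upwards [h1] with c hc
  obtain ⟨T, hT, hTz⟩ := hc
  have hall : ∀ d : Fin n → ℂ, (∀ i, eval d (pderiv i (polyOfCoeffs n k c)) = d i) → d ∈ T := by
    intro d hd
    refine bezout_max n (k - 1) (by omega) (darbouxSys n k c) ?_ T (fun p hp => (hTz p hp).2.1)
      (fun p hp => (hTz p hp).2.2) (hT.trans hS) d fun i => (darbouxSys_eval n k c d i).2 (hd i)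
    intro i
    refine (totalDegree_sub _ _).trans (max_le ?_ ?_)
    · exact (polyOfCoeffs_isHomogeneous n k c).pderiv.totalDegree_le
    · rw [totalDegree_X]; omega
  have h0T : (0 : Fin n → ℂ) ∈ T := hall 0 fun i => grad_zero n k hk c i
  refine ⟨?_, ?_⟩
  · have : {d : Fin n → ℂ | d ≠ 0 ∧ ∀ i, eval d (pderiv i (polyOfCoeffs n k c)) = d i} =
        ↑(T.erase 0) := by
      ext d
      simp only [Set.mem_ofPred_eq, Finset.coe_erase, Set.mem_sdiff, Finset.mem_coe,
        Set.mem_singleton_iff]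
      constructor
      · rintro ⟨h, h'⟩
        exact ⟨hall d h', h⟩
      · rintro ⟨h, h'⟩
        exact ⟨h', fun i => (darbouxSys_eval n k c d i).1 ((hTz d h).2.1 i)⟩
    rw [this, Set.ncard_coe_finset, Finset.card_erase_of_mem h0T, hT, hS]
  · intro d _ hd
    rw [← jacM_darbouxSys]
    exact (hTz d (hall d hd)).2.2

lemma polyOfCoeffs_coeff (n k : ℕ) (V : MvPolynomial (Fin n) ℂ) (hV : V.IsHomogeneous k) :
    polyOfCoeffs n k (fun m => coeff (m : Fin n →₀ ℕ) V) = V := by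
  classical
  unfold polyOfCoeffs
  rw [Finset.sum_coe_sort (expSet n k) (fun m => monomial m (coeff m V))]
  conv_rhs => rw [V.as_sum]
  symm
  refine Finset.sum_subset ?_ ?_
  · intro m hm
    have h := hV (mem_support_iff.1 hm)
    have h' : m.degree = k := by
      rw [Finsupp.degree_eq_weight_one]; exact h
    simp only [expSet, Finset.mem_finsuppAntidiag]
    refine ⟨?_, Finset.subset_univ _⟩
    rw [← Finsupp.degree_eq_sum]
    exact h'
  · intro m _ hm
    rw [notMem_support_iff.1 hm, map_zero]

lemma genericSet_nonempty (n k : ℕ) (hk : 2 < k) : (genericSet n k).Nonempty := by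
  classical
  have hk0 : (k : ℂ) ≠ 0 := by exact_mod_cast (by omega : k ≠ 0)
  set V : MvPolynomial (Fin n) ℂ := ∑ i, C ((k : ℂ)⁻¹) * X i ^ k with hVdef
  have hV : V.IsHomogeneous k := by
    refine IsHomogeneous.sum _ _ _ fun i _ => ?_
    have := (isHomogeneous_C (Fin n) ((k : ℂ)⁻¹)).mul (isHomogeneous_X_pow (R := ℂ) i k)
    simpa using this
  have hgrad : ∀ i, pderiv i V = X i ^ (k - 1) := by
    intro i
    rw [hVdef, map_sum, Finset.sum_eq_single i]
    · rw [pderiv_C_mul, pderiv_pow, pderiv_X_self, mul_one, ← mul_assoc, ← map_natCast C, ← C_mul]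
      rw [inv_mul_cancel₀ hk0, C_1, one_mul]
    · intro j _ hj
      rw [pderiv_C_mul, pderiv_pow, pderiv_X_of_ne hj, mul_zero, mul_zero]
    · simp
  refine ⟨fun m => coeff (m : Fin n →₀ ℕ) V, ?_⟩
  unfold genericSet
  rw [Set.mem_ofPred_eq, polyOfCoeffs_coeff n k V hV]
  simp only [hgrad, map_pow, eval_X]
  obtain ⟨l, rfl⟩ : ∃ l, k = l + 2 := ⟨k - 2, by omega⟩
  have hl : 0 < l := by omega
  have e1 : l + 2 - 1 = l + 1 := by omega
  rw [e1]
  have hroot : ∀ z : ℂ, z ^ (l + 1) = z ↔ z ∈ insert 0 (Polynomial.nthRootsFinset l (1 : ℂ)) := by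
    intro z
    rw [Finset.mem_insert, Polynomial.mem_nthRootsFinset hl]
    constructor
    · intro h
      by_cases hz : z = 0
      · exact Or.inl hz
      · right
        rw [pow_succ] at h
        exact mul_right_cancel₀ hz (h.trans (one_mul z).symm)
    · rintro (rfl | h)
      · simp
      · rw [pow_succ, h, one_mul]
  constructor
  · have : {d : Fin n → ℂ | d ≠ 0 ∧ ∀ i, d i ^ (l + 1) = d i} =
      ↑((Fintype.piFinset fun _ : Fin n =>
        insert 0 (Polynomial.nthRootsFinset l (1 : ℂ))).erase 0) := by
      ext d
      simp only [hroot, Set.mem_ofPred_eq, Finset.mem_coe, Finset.mem_erase, Fintype.mem_piFinset]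
    rw [this, Set.ncard_coe_finset, Finset.card_erase_of_mem, Fintype.card_piFinset]
    · rw [Finset.prod_const, Finset.card_univ, Fintype.card_fin, Finset.card_insert_of_notMem,
        (Complex.isPrimitiveRoot_exp l hl.ne').card_nthRootsFinset]
      rw [Polynomial.mem_nthRootsFinset hl, zero_pow hl.ne']
      exact zero_ne_one
    · simp [Fintype.mem_piFinset]
  · intro d _ hd
    have hK : kovMatrix V d = Matrix.diagonal fun i => ((l + 1 : ℕ) : ℂ) * d i ^ l - 1 := by
      ext i j
      simp only [kovMatrix, hgrad, Matrix.sub_apply, Matrix.of_apply]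
      by_cases h : i = j
      · subst h
        simp
      · simp [h, pderiv_X_of_ne (Ne.symm h)]
    rw [hK, Matrix.det_diagonal, Finset.prod_ne_zero_iff]
    intro i _
    have := (hroot _).1 (hd i)
    rw [Finset.mem_insert, Polynomial.mem_nthRootsFinset hl] at this
    rcases this with h | h
    · rw [h, zero_pow hl.ne']; simp
    · rw [h]
      push_cast
      have : (l : ℂ) ≠ 0 := by exact_mod_cast hl.ne'
      simpa using this

/-- for `n ≥ 1` and `k > 2`, the set `𝓖_k` is open (in the standard
topology of `ℂ^N`, `N = C(n+k-1,k)`) and nonempty. -/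
theorem genericSet_isOpen_nonempty (n k : ℕ) (hn : 1 ≤ n) (hk : 2 < k) :
    IsOpen (genericSet n k) ∧ (genericSet n k).Nonempty := by
  exact ⟨genericSet_isOpen n k hn hk, genericSet_nonempty n k hk⟩
end

section
/- Let V ∈ ℂ[q₁,…,q_n] be homogeneous of degree k > 2 (n ≥ 2) such that the set 𝓓 = {d ∈ ℂⁿ \ {0} : V'(d) = d} has exactly (k−1)ⁿ − 1 elements and the Kovalevskaya matrix V''(d) − E is nonsingular at each d ∈ 𝓓. Then for every 0 ≤ r ≤ n−1, Σ_{d ∈ 𝓓} τ₁(Λ(d))^r / τ_{n−1}(Λ(d)) = (k−2)·(−1)^{n−1}·(2−n−k)^r, where Λ(d) is the multiset of nontrivial Kovalevskaya exponents at d. (Equivalently, the sum over the D(n,k−1) = ((k−1)ⁿ−1)/(k−2) Darboux points in projective space equals (−1)^{n−1}(2−n−k)^r.) -/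
open MvPolynomial

/-- Polynomials of total degree `< e`. -/
noncomputable def degLT (n e : ℕ) : Submodule ℂ (MvPolynomial (Fin n) ℂ) :=
  restrictSupport ℂ {α : Fin n →₀ ℕ | α.degree < e}

lemma mem_degLT {n e : ℕ} {p : MvPolynomial (Fin n) ℂ} :
    p ∈ degLT n e ↔ ∀ α ∈ p.support, α.degree < e := by
  unfold degLT
  rw [mem_restrictSupport_iff]
  exact Iff.rfl

lemma degLT_mono {n a b : ℕ} (h : a ≤ b) : degLT n a ≤ degLT n b := by
  intro p hp
  rw [mem_degLT] at hp ⊢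
  exact fun α hα => (hp α hα).trans_le h

lemma degLT_mul {n a c : ℕ} {p q : MvPolynomial (Fin n) ℂ}
    (hp : p ∈ degLT n (a + 1)) (hq : q ∈ degLT n c) : p * q ∈ degLT n (a + c) := by
  classical
  rw [mem_degLT] at hp hq ⊢
  intro α hα
  obtain ⟨x, hx, y, hy, rfl⟩ := Finset.mem_add.1 (support_mul p q hα)
  have h1 := hp x hx
  have h2 := hq y hy
  rw [map_add]
  omega

lemma C_mem_degLT {n : ℕ} (c : ℂ) (e : ℕ) : C c ∈ degLT n (e + 1) := by
  rw [mem_degLT]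
  intro α hα
  have : α = 0 := by
    classical
    rw [mem_support_iff, coeff_C] at hα
    by_contra h
    exact hα (by rw [if_neg (Ne.symm h)])
  simp [this]

lemma monomial_mem_degLT {n e : ℕ} (α : Fin n →₀ ℕ) (c : ℂ) (h : α.degree < e) :
    monomial α c ∈ degLT n e := by
  rw [mem_degLT]
  intro β hβ
  have := support_monomial_subset hβ
  rw [Finset.mem_singleton] at this
  rwa [this]

lemma homog_mem_degLT {n d e : ℕ} {p : MvPolynomial (Fin n) ℂ} (hp : p.IsHomogeneous d)
    (h : d < e) : p ∈ degLT n e := by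
  rw [mem_degLT]
  intro α hα
  have := hp (mem_support_iff.1 hα)
  have h2 : α.degree = d := by
    rw [Finsupp.degree_eq_weight_one]; exact this
  omega

lemma prod_mem_degLT {n a : ℕ} {ι : Type*} (s : Finset ι) (f : ι → MvPolynomial (Fin n) ℂ)
    (hf : ∀ i, f i ∈ degLT n (a + 1)) : ∏ i ∈ s, f i ∈ degLT n (s.card * a + 1) := by
  classical
  induction s using Finset.induction_on with
  | empty => simpa using C_mem_degLT (n := n) 1 0
  | insert i s hi ih =>
    rw [Finset.prod_insert hi, Finset.card_insert_of_notMem hi]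
    have := degLT_mul (hf i) ih
    convert this using 2
    ring

lemma pow_mem_degLT {n a : ℕ} (p : MvPolynomial (Fin n) ℂ) (hp : p ∈ degLT n (a + 1)) (r : ℕ) :
    p ^ r ∈ degLT n (r * a + 1) := by
  have := prod_mem_degLT (Finset.range r) (fun _ => p) (fun _ => hp)
  simpa using this

lemma prod_sub_prod_mem_degLT {n a : ℕ} {ι : Type*} (s : Finset ι)
    (f g : ι → MvPolynomial (Fin n) ℂ)
    (hf : ∀ i, f i ∈ degLT n (a + 1)) (hg : ∀ i, g i ∈ degLT n (a + 1))
    (hfg : ∀ i, f i - g i ∈ degLT n a) :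
    ∏ i ∈ s, f i - ∏ i ∈ s, g i ∈ degLT n (s.card * a) := by
  classical
  induction s using Finset.induction_on with
  | empty => simp
  | insert i s hi ih =>
    rw [Finset.prod_insert hi, Finset.prod_insert hi, Finset.card_insert_of_notMem hi]
    have h1 := degLT_mul (hf i) ih
    have h2 := degLT_mul (prod_mem_degLT s g hg) (hfg i)
    have : f i * ∏ i ∈ s, f i - g i * ∏ i ∈ s, g i
        = f i * (∏ i ∈ s, f i - ∏ i ∈ s, g i) + (∏ i ∈ s, g i) * (f i - g i) := by ring
    rw [this]
    refine add_mem ?_ ?_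
    · convert h1 using 2; ring
    · convert h2 using 2; ring

lemma det_sub_det_mem_degLT {n a : ℕ} (A B : Matrix (Fin n) (Fin n) (MvPolynomial (Fin n) ℂ))
    (hf : ∀ i j, A i j ∈ degLT n (a + 1)) (hg : ∀ i j, B i j ∈ degLT n (a + 1))
    (hfg : ∀ i j, A i j - B i j ∈ degLT n a) :
    A.det - B.det ∈ degLT n (n * a) := by
  rw [Matrix.det_apply, Matrix.det_apply, ← Finset.sum_sub_distrib]
  refine sum_mem fun σ _ => ?_
  rw [← smul_sub]
  have h := prod_sub_prod_mem_degLT Finset.univ (fun i => A (σ i) i) (fun i => B (σ i) i)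
    (fun i => hf _ _) (fun i => hg _ _) (fun i => hfg _ _)
  rw [Finset.card_univ, Fintype.card_fin] at h
  rcases Int.units_eq_one_or (Equiv.Perm.sign σ) with h1 | h1 <;> rw [h1]
  · simpa using h
  · simpa using neg_mem h


/-- Divided differences for monomials. -/
lemma monomial_divdiff {n : ℕ} (d : ℕ) : ∀ (α : Fin n →₀ ℕ) (_ : α.degree = d),
    ∃ D : Fin n → MvPolynomial (Fin n) ℂ, (∀ j, D j ∈ degLT n d) ∧
      ∀ b : Fin n → ℂ, ∃ Δ : Fin n → MvPolynomial (Fin n) ℂ,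
        (∀ j, Δ j ∈ degLT n d) ∧
        (∀ j, Δ j - D j ∈ degLT n (d - 1)) ∧
        (monomial α 1 - C (eval b (monomial α 1)) = ∑ j, Δ j * (X j - C (b j))) ∧
        ∀ j, eval b (Δ j) = eval b (pderiv j (monomial α 1)) := by
  classical
  induction d with
  | zero =>
    intro α hα
    have h0 : α = 0 := (Finsupp.degree_eq_zero_iff α).1 hα
    subst h0
    refine ⟨0, fun j => by simp, fun b => ⟨0, fun j => by simp, fun j => by simp, ?_, ?_⟩⟩
    · simp
    · intro j
      have : (monomial (0 : Fin n →₀ ℕ) (1 : ℂ)) = 1 := rfl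
      simp [this]
  | succ d ih =>
    intro α hα
    obtain ⟨i, hi⟩ : ∃ i, α i ≠ 0 := by
      by_contra h
      push Not at h
      have : α = 0 := Finsupp.ext h
      simp [this] at hα
    obtain ⟨β, rfl⟩ : ∃ β, α = Finsupp.single i 1 + β := by
      refine ⟨α - Finsupp.single i 1, ?_⟩
      rw [add_tsub_cancel_of_le]
      rw [Finsupp.single_le_iff]
      omega
    have hβ : β.degree = d := by
      rw [map_add, Finsupp.degree_single] at hα
      omega
    obtain ⟨D0, hD0, hΔ⟩ := ih β hβ
    have hmon : (monomial (Finsupp.single i 1 + β) (1 : ℂ)) = X i * monomial β 1 := by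
      rw [X, monomial_mul, one_mul]
    have hmem : monomial β (1 : ℂ) ∈ degLT n (d + 1) := monomial_mem_degLT _ _ (by omega)
    refine ⟨fun j => if j = i then monomial β 1 else 0, ?_, fun b => ?_⟩
    · intro j
      dsimp only
      split_ifs
      · exact hmem
      · exact zero_mem _
    obtain ⟨Δ, h1, -, h3, h4⟩ := hΔ b
    have hm : ∀ j, C (b i) * Δ j ∈ degLT n d := fun j => by
      simpa using degLT_mul (C_mem_degLT (n := n) (b i) 0) (h1 j)
    refine ⟨fun j => (if j = i then monomial β 1 else 0) + C (b i) * Δ j, ?_, ?_, ?_, ?_⟩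
    · intro j
      refine add_mem ?_ (degLT_mono (Nat.le_succ d) (hm j))
      split_ifs
      · exact hmem
      · exact zero_mem _
    · intro j
      simpa using hm j
    · rw [hmon]
      simp only [add_mul, Finset.sum_add_distrib, ite_mul, zero_mul, Finset.sum_ite_eq',
        Finset.mem_univ, if_true, mul_assoc]
      rw [← Finset.mul_sum, ← h3]
      simp only [map_mul, eval_X]
      ring
    · intro j
      rw [hmon, pderiv_mul]
      by_cases hj : j = i
      · subst hj
        simp [h4]
      · rw [pderiv_X_of_ne (Ne.symm hj)]
        simp [hj, h4]

lemma poly_divdiff {n m : ℕ} (p : MvPolynomial (Fin n) ℂ) (hp : p ∈ degLT n (m + 1)) :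
    ∃ D : Fin n → MvPolynomial (Fin n) ℂ, (∀ j, D j ∈ degLT n m) ∧
      ∀ b : Fin n → ℂ, ∃ Δ : Fin n → MvPolynomial (Fin n) ℂ,
        (∀ j, Δ j ∈ degLT n m) ∧
        (∀ j, Δ j - D j ∈ degLT n (m - 1)) ∧
        (p - C (eval b p) = ∑ j, Δ j * (X j - C (b j))) ∧
        ∀ j, eval b (Δ j) = eval b (pderiv j p) := by
  unfold degLT at hp
  rw [restrictSupport_eq_span] at hp
  induction hp using Submodule.span_induction with
  | mem x hx =>
    obtain ⟨α, hα, rfl⟩ := hx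
    have hα' : α.degree < m + 1 := hα
    obtain ⟨D, hD, h⟩ := monomial_divdiff α.degree α rfl
    rcases Nat.lt_succ_iff_lt_or_eq.1 hα' with h1 | h1
    · refine ⟨0, fun j => zero_mem _, fun b => ?_⟩
      obtain ⟨Δ, h2, -, h4, h5⟩ := h b
      refine ⟨Δ, fun j => degLT_mono h1.le (h2 j), fun j => ?_, h4, h5⟩
      simpa using degLT_mono (by omega) (h2 j)
    · rw [h1] at h hD
      exact ⟨D, hD, h⟩
  | zero =>
    exact ⟨0, fun j => zero_mem _, fun b => ⟨0, fun j => zero_mem _, fun j => by simp, by simp,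
      by simp⟩⟩
  | add p q _ _ hp hq =>
    obtain ⟨D, hD, h⟩ := hp
    obtain ⟨D', hD', h'⟩ := hq
    refine ⟨D + D', fun j => add_mem (hD j) (hD' j), fun b => ?_⟩
    obtain ⟨Δ, h2, h3, h4, h5⟩ := h b
    obtain ⟨Δ', h2', h3', h4', h5'⟩ := h' b
    refine ⟨Δ + Δ', fun j => add_mem (h2 j) (h2' j), fun j => ?_, ?_, fun j => ?_⟩
    · have := add_mem (h3 j) (h3' j)
      simp only [Pi.add_apply]
      convert this using 1
      ring
    · simp only [Pi.add_apply, add_mul, Finset.sum_add_distrib, ← h4, ← h4', map_add]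
      ring
    · simp [h5, h5']
  | smul a p _ hp =>
    obtain ⟨D, hD, h⟩ := hp
    refine ⟨a • D, fun j => Submodule.smul_mem _ _ (hD j), fun b => ?_⟩
    obtain ⟨Δ, h2, h3, h4, h5⟩ := h b
    refine ⟨a • Δ, fun j => Submodule.smul_mem _ _ (h2 j), fun j => ?_, ?_, fun j => ?_⟩
    · have := Submodule.smul_mem _ a (h3 j)
      rwa [smul_sub] at this
    · simp only [Pi.smul_apply, smul_mul_assoc, ← Finset.smul_sum, ← h4, smul_sub]
      simp [smul_eq_C_mul]
    · simp [h5, smul_eval]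

lemma bezoutian {n m : ℕ} (F : Fin n → MvPolynomial (Fin n) ℂ)
    (hF : ∀ i, F i ∈ degLT n (m + 1 + 1)) :
    ∃ T : MvPolynomial (Fin n) ℂ, ∀ b : Fin n → ℂ, (∀ i, eval b (F i) = 0) →
      ∃ B : MvPolynomial (Fin n) ℂ, B - T ∈ degLT n (n * m) ∧
        eval b B = (Matrix.of fun i j => eval b (pderiv j (F i))).det ∧
        ∀ a : Fin n → ℂ, (∀ i, eval a (F i) = 0) → a ≠ b → eval a B = 0 := by
  choose D hD h using fun i => poly_divdiff (F i) (hF i)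
  refine ⟨(Matrix.of D).det, fun b hb => ?_⟩
  choose Δ h2 h3 h4 h5 using fun i => h i b
  refine ⟨(Matrix.of Δ).det, ?_, ?_, ?_⟩
  · exact det_sub_det_mem_degLT _ _ (fun i j => h2 i j) (fun i j => hD i j) (fun i j => h3 i j)
  · rw [RingHom.map_det]
    congr 1
    ext i j
    exact h5 i j
  · intro a ha hab
    rw [RingHom.map_det]
    rw [← Matrix.exists_mulVec_eq_zero_iff]
    refine ⟨a - b, sub_ne_zero.2 hab, ?_⟩
    ext i
    have := congrArg (eval a) (h4 i)
    simp only [map_sub, ha, hb, map_sum, map_mul, eval_X, eval_C, map_zero, sub_zero] at this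
    simp only [Matrix.mulVec, dotProduct]
    exact this.symm


lemma hasStrictFDerivAt_eval {n : ℕ} (p : MvPolynomial (Fin n) ℂ) (b : Fin n → ℂ) :
    HasStrictFDerivAt (fun x : Fin n → ℂ => eval x p)
      (∑ j, eval b (pderiv j p) • (ContinuousLinearMap.proj j : (Fin n → ℂ) →L[ℂ] ℂ)) b := by
  classical
  induction p using MvPolynomial.induction_on with
  | C a =>
    simp only [eval_C]
    refine (hasStrictFDerivAt_const (𝕜 := ℂ) a b).congr_fderiv ?_
    ext v
    simp
  | add p q hp hq =>
    simp only [map_add]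
    refine (hp.add hq).congr_fderiv ?_
    ext v
    simp [add_mul, Finset.sum_add_distrib]
  | mul_X p i hp =>
    simp only [map_mul, eval_X]
    have h := hp.mul (ContinuousLinearMap.proj (R := ℂ) (φ := fun _ : Fin n => ℂ) i).hasStrictFDerivAt
    refine h.congr_fderiv ?_
    ext v
    simp [pderiv_X, Pi.single_apply, add_mul, Finset.sum_add_distrib, Finset.mul_sum, mul_assoc,
      apply_ite (eval b)]

open Filter Topology in
lemma exists_branch {n : ℕ} (F : Fin n → MvPolynomial (Fin n) ℂ) (m : ℕ) (b : Fin n → ℂ)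
    (hb : ∀ i, eval b (F i) = 0)
    (hJ : (Matrix.of fun i j => eval b (pderiv j (F i))).det ≠ 0) :
    ∃ c : ℂ → Fin n → ℂ, Tendsto c (𝓝 0) (𝓝 b) ∧
      ∀ᶠ t in 𝓝 (0 : ℂ), ∀ i, eval (c t) (F i) + t * c t i ^ m = 0 := by
  let f : ℂ × (Fin n → ℂ) → (Fin n → ℂ) := fun v i => eval v.2 (F i) + v.1 * v.2 i ^ m
  have h1 : ∀ i, HasStrictFDerivAt (fun v : ℂ × (Fin n → ℂ) => f v i) _ ((0 : ℂ), b) := fun i =>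
    ((hasStrictFDerivAt_eval (F i) b).comp ((0 : ℂ), b)
      (hasStrictFDerivAt_snd (𝕜 := ℂ) (E := ℂ) (F := Fin n → ℂ) (p := ((0 : ℂ), b)))).add
     ((hasStrictFDerivAt_fst (𝕜 := ℂ) (E := ℂ) (F := Fin n → ℂ) (p := ((0 : ℂ), b))).mul
      (((ContinuousLinearMap.proj (R := ℂ) (φ := fun _ : Fin n => ℂ) i).comp
        (ContinuousLinearMap.snd ℂ ℂ (Fin n → ℂ))).hasStrictFDerivAt.pow m))
  obtain ⟨L, hL, hL2⟩ : ∃ L : ℂ × (Fin n → ℂ) →L[ℂ] (Fin n → ℂ),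
      HasStrictFDerivAt f L ((0 : ℂ), b) ∧
      ∀ v, L (0, v) = (Matrix.of fun i j => eval b (pderiv j (F i))).mulVec v := by
    refine ⟨_, hasStrictFDerivAt_pi.2 h1, fun v => ?_⟩
    ext i
    simp [Matrix.mulVec, dotProduct]
  have w : (L.comp (ContinuousLinearMap.inr ℂ ℂ (Fin n → ℂ))).IsInvertible := by
    have hinj : Function.Injective (L.comp (ContinuousLinearMap.inr ℂ ℂ (Fin n → ℂ))) := by
      rw [injective_iff_map_eq_zero]
      intro v hv
      have hv' : L (0, v) = 0 := hv
      rw [hL2] at hv'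
      exact Matrix.eq_zero_of_mulVec_eq_zero hJ hv'
    refine ⟨(LinearEquiv.ofInjectiveEndo
      (L.comp (ContinuousLinearMap.inr ℂ ℂ (Fin n → ℂ))).toLinearMap hinj).toContinuousLinearEquiv,
      ?_⟩
    ext v
    rfl
  refine ⟨_, hL.tendsto_implicitFunctionOfProdDomain w, ?_⟩
  filter_upwards [hL.eventually_apply_implicitFunctionOfProdDomain w] with t ht i
  have := congrFun ht i
  simpa [f, hb] using this

instance degLT_finite (n e : ℕ) : Module.Finite ℂ (degLT n e) := by
  have hfin : Set.Finite {α : Fin n →₀ ℕ | α.degree < e} := by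
    refine Set.Finite.subset (Finsupp.finite_of_degree_le (σ := Fin n) e) ?_
    intro α hα
    exact le_of_lt (a := α.degree) hα
  have : Finite {α : Fin n →₀ ℕ | α.degree < e} := hfin
  exact Module.Finite.of_basis (basisRestrictSupport ℂ {α : Fin n →₀ ℕ | α.degree < e})

lemma degenerate_det {n m : ℕ} (F : Fin n → MvPolynomial (Fin n) ℂ)
    (hF : ∀ i, F i ∈ degLT n (m + 1 + 1)) :
    ∃ S : Set ℂ, S.Finite ∧ ∀ t ∉ S, ∀ (ι : Type) [Fintype ι] [DecidableEq ι]
      (_ : Fintype.card ι = (m + 1) ^ n) (c : ι → Fin n → ℂ)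
      (_ : ∀ x i, eval (c x) (F i) + t * c x i ^ (m + 1) = 0)
      (g : ι → MvPolynomial (Fin n) ℂ) (_ : ∀ x, g x ∈ degLT n (n * m)),
      (Matrix.of fun x y => eval (c y) (g x)).det = 0 := by
  classical
  obtain ⟨N0, hN0⟩ : ∃ N0 : MvPolynomial (Fin n) ℂ →ₗ[ℂ] MvPolynomial (Fin n) ℂ,
      ∀ α : Fin n →₀ ℕ, N0 (monomial α 1) = if h : ∃ i, m + 1 ≤ α i then
        monomial (α - Finsupp.single h.choose (m + 1)) 1 * F h.choose else 0 := by
    refine ⟨(basisMonomials (Fin n) ℂ).constr ℂ (fun α =>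
      if h : ∃ i, m + 1 ≤ α i then
        monomial (α - Finsupp.single h.choose (m + 1)) 1 * F h.choose else 0), fun α => ?_⟩
    have := (basisMonomials (Fin n) ℂ).constr_basis ℂ (fun α =>
      if h : ∃ i, m + 1 ≤ α i then
        monomial (α - Finsupp.single h.choose (m + 1)) 1 * F h.choose else 0) α
    rwa [coe_basisMonomials] at this
  have hdec : ∀ (α : Fin n →₀ ℕ) (i : Fin n), m + 1 ≤ α i →
      α - Finsupp.single i (m + 1) + Finsupp.single i (m + 1) = α := by
    intro α i hi
    rw [tsub_add_cancel_of_le]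
    rwa [Finsupp.single_le_iff]
  have hmap : ∀ p ∈ degLT n (n * m), N0 p ∈ degLT n (n * m) := by
    intro p hp
    have hp' := hp
    unfold degLT at hp'
    rw [restrictSupport_eq_span] at hp'
    refine Submodule.span_le (p := (degLT n (n * m)).comap N0) |>.2 ?_ hp'
    rintro _ ⟨α, hα, rfl⟩
    have hα' : α.degree < n * m := hα
    simp only [Submodule.comap_coe, Set.mem_preimage, hN0]
    split_ifs with h
    · have h1 := congrArg Finsupp.degree (hdec α _ h.choose_spec)
      rw [map_add, Finsupp.degree_single] at h1
      have h2 : monomial (α - Finsupp.single h.choose (m + 1)) (1 : ℂ)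
        ∈ degLT n (n * m - (m + 2) + 1) := monomial_mem_degLT _ _ (by omega)
      have h3 := degLT_mul h2 (hF h.choose)
      have h4 : n * m - (m + 2) + (m + 1 + 1) = n * m := by omega
      rwa [h4] at h3
    · exact zero_mem _
  let N : Module.End ℂ (degLT n (n * m)) := N0.restrict hmap
  refine ⟨Set.preimage (fun t : ℂ => -t) {μ | N.HasEigenvalue μ},
    N.finite_hasEigenvalue.preimage neg_injective.injOn, ?_⟩
  intro t ht ι _ _ hι c hc g hg
  have hinj : Function.Injective (N + t • (1 : Module.End ℂ (degLT n (n * m)))) := by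
    rw [injective_iff_map_eq_zero]
    intro v hv
    by_contra hv0
    apply ht
    refine Module.End.hasEigenvalue_of_hasEigenvector (x := v) ⟨?_, hv0⟩
    rw [Module.End.mem_eigenspace_iff]
    simp only [LinearMap.add_apply, LinearMap.smul_apply, Module.End.one_apply] at hv
    rw [neg_smul]
    exact eq_neg_of_add_eq_zero_left hv
  have hsurj := LinearMap.surjective_of_injective hinj
  obtain ⟨L, hL⟩ : ∃ L : MvPolynomial (Fin n) ℂ →ₗ[ℂ] (ι → ℂ),
      ∀ p y, L p y = eval (c y) p := by
    refine ⟨LinearMap.pi fun y => (aeval (c y) : MvPolynomial (Fin n) ℂ →ₐ[ℂ] ℂ).toLinearMap, ?_⟩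
    intro p y
    simp [aeval_eq_eval]
  let a0 : Fin n → Fin (m + 1) := fun _ => Fin.last m
  let s : Finset (ι → ℂ) := (Finset.univ.erase a0).image fun a =>
    L (monomial (Finsupp.equivFunOnFinite.symm fun i => (a i : ℕ)) 1)
  have hs : s.card < (m + 1) ^ n := by
    refine Finset.card_image_le.trans_lt ?_
    rw [Finset.card_erase_of_mem (Finset.mem_univ _), Finset.card_univ]
    simp only [Fintype.card_fun, Fintype.card_fin]
    exact Nat.sub_lt (by positivity) one_pos
  have hspan : ∀ p ∈ degLT n (n * m), L (N0 p + t • p) ∈ Submodule.span ℂ (s : Set (ι → ℂ)) := by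
    intro p hp
    have hp' := hp
    unfold degLT at hp'
    rw [restrictSupport_eq_span] at hp'
    suffices hk : Submodule.span ℂ (Set.image (monomial · (1 : ℂ))
        {α : Fin n →₀ ℕ | α.degree < n * m})
        ≤ (Submodule.span ℂ (s : Set (ι → ℂ))).comap (L ∘ₗ (N0 + t • LinearMap.id)) from hk hp'
    rw [Submodule.span_le]
    rintro _ ⟨α, hα, rfl⟩
    have hα' : α.degree < n * m := hα
    simp only [Submodule.comap_coe, Set.mem_preimage, LinearMap.comp_apply, LinearMap.add_apply,
      LinearMap.smul_apply, LinearMap.id_apply, hN0]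
    split_ifs with h
    · suffices h0 : L (monomial (α - Finsupp.single h.choose (m + 1)) 1 * F h.choose
          + t • monomial α 1) = 0 by
        rw [SetLike.mem_coe, h0]
        exact zero_mem _
      ext y
      rw [hL]
      have h1 : monomial α (1 : ℂ) = monomial (α - Finsupp.single h.choose (m + 1)) 1
          * X h.choose ^ (m + 1) := by
        rw [X_pow_eq_monomial, monomial_mul, hdec α _ h.choose_spec, one_mul]
      have h2 := hc y h.choose
      rw [h1]
      simp only [map_add, map_mul, smul_eval, map_pow, eval_X, Pi.zero_apply]
      linear_combination (eval (c y) (monomial (α - Finsupp.single h.choose (m + 1)) 1)) * h2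
    · push Not at h
      rw [zero_add, map_smul]
      refine Submodule.smul_mem _ _ (Submodule.subset_span ?_)
      refine Finset.mem_coe.2 (Finset.mem_image.2 ⟨fun i => ⟨α i, h i⟩, ?_, ?_⟩)
      · refine Finset.mem_erase.2 ⟨?_, Finset.mem_univ _⟩
        intro h0
        have h3 : ∀ i, α i = m := fun i => congrArg Fin.val (congrFun h0 i)
        rw [Finsupp.degree_eq_sum] at hα'
        simp [h3] at hα'
      · have h3 : (Finsupp.equivFunOnFinite.symm fun i => α i) = α := by
          ext i
          rfl
        exact congrArg (fun β => L (monomial β 1)) h3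
  have hg2 : ∀ x, L (g x) ∈ Submodule.span ℂ (s : Set (ι → ℂ)) := by
    intro x
    obtain ⟨v, hv⟩ := hsurj ⟨g x, hg x⟩
    have h1 := congrArg Subtype.val hv
    have h2 : N0 v.1 + t • v.1 = g x := h1
    rw [← h2]
    exact hspan _ v.2
  by_contra hdet
  have hli := Matrix.linearIndependent_rows_of_det_ne_zero hdet
  have h1 : Module.finrank ℂ (Submodule.span ℂ
      (Set.range (Matrix.of fun x y => eval (c y) (g x)).row)) = Fintype.card ι :=
    finrank_span_eq_card hli
  have h2 : Submodule.span ℂ (Set.range (Matrix.of fun x y => eval (c y) (g x)).row) ≤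
      Submodule.span ℂ (s : Set (ι → ℂ)) := by
    rw [Submodule.span_le]
    rintro _ ⟨x, rfl⟩
    have : (Matrix.of fun x y => eval (c y) (g x)).row x = L (g x) := by
      ext y
      rw [hL]
      rfl
    rw [this]
    exact hg2 x
  have h3 := Submodule.finrank_mono h2
  have h4 := finrank_span_finset_le_card (R := ℂ) s
  unfold Set.finrank at h4
  omega

open Filter Topology in
lemma exists_weights {n m : ℕ} (F : Fin n → MvPolynomial (Fin n) ℂ)
    (hF : ∀ i, F i ∈ degLT n (m + 1 + 1)) (Z : Finset (Fin n → ℂ))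
    (hZ : ∀ b ∈ Z, ∀ i, eval b (F i) = 0) (hcard : Z.card = (m + 1) ^ n)
    (hJ : ∀ b ∈ Z, (Matrix.of fun i j => eval b (pderiv j (F i))).det ≠ 0) :
    ∃ w : Z → ℂ, w ≠ 0 ∧ ∀ g ∈ degLT n (n * m), ∑ x : Z, eval x.1 g * w x = 0 := by
  classical
  obtain ⟨L, hL⟩ : ∃ L : MvPolynomial (Fin n) ℂ →ₗ[ℂ] (Z → ℂ),
      ∀ p y, L p y = eval y.1 p := by
    refine ⟨LinearMap.pi fun y => (aeval y.1 : MvPolynomial (Fin n) ℂ →ₐ[ℂ] ℂ).toLinearMap, ?_⟩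
    intro p y
    simp [aeval_eq_eval]
  by_cases htop : (degLT n (n * m)).map L = ⊤
  · exfalso
    have hex : ∀ x : Z, ∃ g ∈ degLT n (n * m), L g = Pi.single x 1 := fun x => by
      have : (Pi.single x 1 : Z → ℂ) ∈ (degLT n (n * m)).map L := htop ▸ Submodule.mem_top
      exact Submodule.mem_map.1 this
    choose g hg hg1 using hex
    choose c hc1 hc2 using fun x : Z => exists_branch F (m + 1) x.1 (hZ x.1 x.2) (hJ x.1 x.2)
    obtain ⟨S, hS, hdet⟩ := degenerate_det F hF
    let Φ : (Z → Fin n → ℂ) → ℂ := fun cc => (Matrix.of fun x y => eval (cc y) (g x)).det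
    have hΦ : Continuous Φ := by
      refine Continuous.matrix_det ?_
      refine continuous_matrix fun x y => ?_
      exact (MvPolynomial.continuous_eval (g x)).comp (continuous_apply y)
    have h1 : Tendsto (fun t x => c x t) (𝓝 0) (𝓝 (fun x : Z => x.1)) :=
      tendsto_pi_nhds.2 hc1
    have h2 := (hΦ.tendsto _).comp h1
    have h3 : Φ (fun x : Z => x.1) = 1 := by
      have : (Matrix.of fun x y : Z => eval y.1 (g x)) = 1 := by
        ext x y
        rw [Matrix.of_apply, ← hL, hg1, Matrix.one_apply, Pi.single_apply]
        simp only [eq_comm]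
      show Matrix.det _ = 1
      rw [this, Matrix.det_one]
    rw [h3] at h2
    have h4 : ∀ᶠ t in 𝓝[≠] (0 : ℂ), Φ (fun x => c x t) ≠ 0 :=
      (h2.eventually_ne one_ne_zero).filter_mono nhdsWithin_le_nhds
    have h5 : ∀ᶠ t in 𝓝[≠] (0 : ℂ), ∀ x i, eval (c x t) (F i) + t * c x t i ^ (m + 1) = 0 :=
      (eventually_all.2 hc2).filter_mono nhdsWithin_le_nhds
    have h6 : ∀ᶠ t in 𝓝[≠] (0 : ℂ), t ∉ S :=
      nhdsNE_le_cofinite 0 hS.compl_mem_cofinite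
    obtain ⟨t, ht4, ht5, ht6⟩ := (h4.and (h5.and h6)).exists
    exact ht4 (hdet t ht6 Z (by simpa using hcard) (fun x => c x t) ht5 g hg)
  · obtain ⟨f, hf0, hf⟩ := Submodule.exists_le_ker_of_lt_top _ (lt_top_iff_ne_top.2 htop)
    have hsum : ∀ v, f v = ∑ x, v x * f (Pi.single x 1) := by
      intro v
      have := LinearMap.pi_apply_eq_sum_univ f v
      rw [this]
      refine Finset.sum_congr rfl fun x _ => ?_
      rw [smul_eq_mul]
      congr 2
      ext y
      simp [Pi.single_apply, eq_comm]
    refine ⟨fun x => f (Pi.single x 1), ?_, ?_⟩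
    · intro h0
      apply hf0
      ext x
      exact congrFun h0 x
    · intro g hg
      have h1 : f (L g) = 0 := hf (Submodule.mem_map_of_mem hg)
      rw [hsum] at h1
      simpa only [hL] using h1

/-- Euler–Jacobi vanishing. -/
lemma euler_jacobi {n m : ℕ} (F : Fin n → MvPolynomial (Fin n) ℂ)
    (hF : ∀ i, F i ∈ degLT n (m + 1 + 1)) (Z : Finset (Fin n → ℂ))
    (hZ : ∀ b ∈ Z, ∀ i, eval b (F i) = 0) (hcard : Z.card = (m + 1) ^ n)
    (hJ : ∀ b ∈ Z, (Matrix.of fun i j => eval b (pderiv j (F i))).det ≠ 0)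
    (g : MvPolynomial (Fin n) ℂ) (hg : g ∈ degLT n (n * m)) :
    ∑ b ∈ Z, eval b g / (Matrix.of fun i j => eval b (pderiv j (F i))).det = 0 := by
  classical
  obtain ⟨w, hw0, hw⟩ := exists_weights F hF Z hZ hcard hJ
  obtain ⟨T, hT⟩ := bezoutian F hF
  have hkey : ∀ x : Z, (Matrix.of fun i j => eval x.1 (pderiv j (F i))).det * w x
      = ∑ y : Z, eval y.1 T * w y := by
    intro x
    obtain ⟨B, h1, h2, h3⟩ := hT x.1 (hZ x.1 x.2)
    have h4 := hw _ h1
    simp only [map_sub, sub_mul, Finset.sum_sub_distrib] at h4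
    rw [← sub_eq_zero.1 h4, Finset.sum_eq_single x, h2]
    · intro y _ hy
      rw [h3 y.1 (hZ y.1 y.2) (fun h => hy (Subtype.ext h)), zero_mul]
    · intro h
      exact absurd (Finset.mem_univ _) h
  set c := ∑ y : Z, eval y.1 T * w y with hc
  have hc0 : c ≠ 0 := by
    intro h
    apply hw0
    ext x
    have := hkey x
    rw [h] at this
    exact (mul_eq_zero.1 this).resolve_left (hJ x.1 x.2)
  have h5 := hw g hg
  rw [← Finset.sum_coe_sort]
  have h6 : c * ∑ x : Z, eval x.1 g / (Matrix.of fun i j => eval x.1 (pderiv j (F i))).det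
      = ∑ x : Z, eval x.1 g * w x := by
    rw [Finset.mul_sum]
    refine Finset.sum_congr rfl fun x _ => ?_
    rw [← hkey x]
    have := hJ x.1 x.2
    field_simp
  rw [h5] at h6
  exact (mul_eq_zero.1 h6).resolve_left hc0

lemma homog_eval_zero {n d : ℕ} {p : MvPolynomial (Fin n) ℂ} (hp : p.IsHomogeneous d)
    (hd : d ≠ 0) : eval 0 p = 0 := by
  have h1 : eval 0 p = constantCoeff p := by simp
  rw [h1, constantCoeff_eq]
  refine hp.coeff_eq_zero ?_
  rw [map_zero]
  exact hd.symm

lemma pderiv_swap {n : ℕ} (i j : Fin n) (p : MvPolynomial (Fin n) ℂ) :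
    pderiv i (pderiv j p) = pderiv j (pderiv i p) := by
  classical
  induction p using MvPolynomial.induction_on with
  | C a => simp
  | add p q hp hq => simp [hp, hq]
  | mul_X p k hp =>
    simp only [pderiv_mul, map_add, hp, pderiv_X, Pi.single_apply]
    split_ifs <;> simp <;> ring

theorem potential_relation_tau1_pow
    (n k : ℕ) (hn : 2 ≤ n) (hk : 2 < k)
    (V : MvPolynomial (Fin n) ℂ) (hV : V.IsHomogeneous k)
    (D : Finset (Fin n → ℂ))
    (hD : ∀ d, d ∈ D ↔ d ≠ 0 ∧ ∀ i, eval d (pderiv i V) = d i)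
    (hcard : D.card = (k - 1) ^ n - 1)
    (hK : ∀ d ∈ D, ((Matrix.of fun i j => eval d (pderiv i (pderiv j V))) - 1).det ≠ 0)
    (Λ : (Fin n → ℂ) → Fin (n - 1) → ℂ)
    (hΛ : ∀ d ∈ D,
      ((Matrix.of fun i j => eval d (pderiv i (pderiv j V))) - 1).charpoly.roots
        = ((k : ℂ) - 2) ::ₘ Multiset.map (Λ d) Finset.univ.val) :
    ∀ r : ℕ, r ≤ n - 1 →
      ∑ d ∈ D, (∑ j, Λ d j) ^ r / ∏ j, Λ d j
        = ((k : ℂ) - 2) * (-1 : ℂ) ^ (n - 1) * (2 - (n : ℂ) - (k : ℂ)) ^ r := by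
  classical
  intro r hr
  obtain ⟨m, rfl⟩ : ∃ m, k = m + 2 := ⟨k - 2, by omega⟩
  have hm : 0 < m := by omega
  have hm0 : (m : ℂ) ≠ 0 := by exact_mod_cast hm.ne'
  have hkm : (((m + 2 : ℕ) : ℂ) - 2) = m := by push_cast; ring
  have h1 : ∀ i, (pderiv i V).IsHomogeneous (m + 1) := fun i => hV.pderiv
  have h2 : ∀ i j, (pderiv i (pderiv j V)).IsHomogeneous m := fun i j => (h1 j).pderiv
  have hz1 : ∀ i, eval 0 (pderiv i V) = 0 := fun i => homog_eval_zero (h1 i) (by omega)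
  have hz2 : ∀ i j, eval 0 (pderiv i (pderiv j V)) = 0 := fun i j => homog_eval_zero (h2 i j) hm.ne'
  let F : Fin n → MvPolynomial (Fin n) ℂ := fun i => pderiv i V - X i
  have hFJ : ∀ b, (Matrix.of fun i j => eval b (pderiv j (F i)))
      = (Matrix.of fun i j => eval b (pderiv i (pderiv j V))) - 1 := by
    intro b
    ext i j
    simp only [F, map_sub, Matrix.sub_apply, Matrix.of_apply, pderiv_swap j i, pderiv_X,
      Matrix.one_apply, Pi.single_apply]
    split_ifs <;> simp_all
  have hJ0 : ((Matrix.of fun i j => eval (0 : Fin n → ℂ) (pderiv i (pderiv j V))) - 1).det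
      = (-1) ^ n := by
    have : (Matrix.of fun i j => eval (0 : Fin n → ℂ) (pderiv i (pderiv j V))) = 0 := by
      ext i j
      exact hz2 i j
    rw [this, zero_sub, Matrix.det_neg, Matrix.det_one, Fintype.card_fin, mul_one]
  have h0D : (0 : Fin n → ℂ) ∉ D := fun h => ((hD 0).1 h).1 rfl
  let q : MvPolynomial (Fin n) ℂ := ∑ i, pderiv i (pderiv i V) + C (-(n : ℂ) - m)
  have hq : q ^ r ∈ degLT n (n * m) := by
    have : q ∈ degLT n (m + 1) :=
      add_mem (sum_mem fun i _ => homog_mem_degLT (h2 i i) (Nat.lt_succ_self m)) (C_mem_degLT _ _)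
    refine degLT_mono ?_ (pow_mem_degLT q this r)
    have : (r + 1) * m ≤ n * m := Nat.mul_le_mul_right m (by omega)
    nlinarith
  have hEJ := euler_jacobi F (m := m) (fun i => sub_mem
      (homog_mem_degLT (h1 i) (by omega)) (homog_mem_degLT (isHomogeneous_X ℂ i) (by omega)))
    (insert 0 D) ?_ ?_ ?_ (q ^ r) hq
  rotate_left
  · intro b hb i
    rcases Finset.mem_insert.1 hb with rfl | hb
    · have := hz1 i
      simp only [F, map_sub, eval_X, Pi.zero_apply, this, sub_zero]
    · simp [F, ((hD b).1 hb).2 i]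
  · rw [Finset.card_insert_of_notMem h0D, hcard]
    have : 0 < (m + 1) ^ n := by positivity
    have h3 : m + 2 - 1 = m + 1 := by omega
    rw [h3]
    omega
  · intro b hb
    rw [hFJ]
    rcases Finset.mem_insert.1 hb with rfl | hb
    · rw [hJ0]
      exact pow_ne_zero _ (by norm_num)
    · exact hK b hb
  rw [Finset.sum_insert h0D] at hEJ
  simp only [hFJ, hJ0, map_pow] at hEJ
  have hq0 : eval 0 q = -(n : ℂ) - m := by
    simp only [q, map_add, map_sum, hz2, Finset.sum_const_zero, eval_C, zero_add]
  have hterm : ∀ d ∈ D, (∑ j, Λ d j) ^ r / ∏ j, Λ d j = m * (eval d q ^ r /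
      ((Matrix.of fun i j => eval d (pderiv i (pderiv j V))) - 1).det) := by
    intro d hd
    have hdet := Matrix.det_eq_prod_roots_charpoly
      ((Matrix.of fun i j => eval d (pderiv i (pderiv j V))) - 1)
    have htr := Matrix.trace_eq_sum_roots_charpoly
      ((Matrix.of fun i j => eval d (pderiv i (pderiv j V))) - 1)
    rw [hΛ d hd, Multiset.prod_cons, hkm] at hdet
    rw [hΛ d hd, Multiset.sum_cons, hkm, Matrix.trace_sub, Matrix.trace_one, Fintype.card_fin]
      at htr
    have hp : (Multiset.map (Λ d) Finset.univ.val).prod = ∏ j, Λ d j := rfl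
    have hs : (Multiset.map (Λ d) Finset.univ.val).sum = ∑ j, Λ d j := rfl
    rw [hp] at hdet
    rw [hs] at htr
    have hqd : eval d q = ∑ j, Λ d j := by
      have : eval d q = (Matrix.of fun i j => eval d (pderiv i (pderiv j V))).trace - n - m := by
        simp [q, Matrix.trace]
        ring
      rw [this, htr]
      ring
    have hne := hK d hd
    rw [hdet] at hne ⊢
    rw [hqd]
    have := right_ne_zero_of_mul hne
    field_simp
  rw [Finset.sum_congr rfl hterm, ← Finset.mul_sum, eq_neg_of_add_eq_zero_right hEJ, hq0, hkm]
  obtain ⟨n', rfl⟩ : ∃ n', n = n' + 1 := ⟨n - 1, by omega⟩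
  have hb : (2 - ((n' + 1 : ℕ) : ℂ) - ((m + 2 : ℕ) : ℂ)) = -((n' + 1 : ℕ) : ℂ) - m := by
    push_cast; ring
  rw [hb, Nat.add_sub_cancel, pow_succ]
  rcases neg_one_pow_eq_or ℂ n' with h | h <;> rw [h] <;> ring
end
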